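/- Let X be an n-dimensional pure-dimensional analytic subset of a domain in ℂ^N passing through the origin, with N ≥ 2. Then there is a neighborhood U of 0 such that for every 0 ≤ ε < 1, the integral over U ∩ X_reg of (|z_1|^2 + ⋯ + |z_N|^2)^{-(n-1+ε)} against the volume form induced by the standard Kähler metric of ℂ^N is finite. -/

import Mathlib

open MeasureTheory

/-- `X` is an analytic subset of `D`: locally on `D` it is the common zero set of finitely
many holomorphic functions. -/
def IsAnalyticIn {N : ℕ} (X D : Set (Fin N → ℂ)) : Prop :=
  X ⊆ D ∧ ∀ x ∈ D, ∃ U ∈ nhds x, U ⊆ D ∧ ∃ (r : ℕ) (f : Fin r → (Fin N → ℂ) → ℂ),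
    (∀ i, DifferentiableOn ℂ (f i) U) ∧ X ∩ U = {z ∈ U | ∀ i, f i z = 0}

/-- `X` has pure (complex) dimension `n`: near every point of `X` it has Hausdorff
dimension `2n`. -/
def IsPureDimensional {N : ℕ} (X : Set (Fin N → ℂ)) (n : ℕ) : Prop :=
  ∀ x ∈ X, ∀ U ∈ nhds x, dimH (X ∩ U) = (2 * n : ℕ)

namespace AnSet
open Metric Set Filter Topology

lemma holo_continuousOn_fderiv {E F : Type*} [NormedAddCommGroup E] [NormedSpace ℂ E]
    [FiniteDimensional ℂ E] [NormedAddCommGroup F] [NormedSpace ℂ F]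
    {U : Set E} (hU : IsOpen U) {f : E → F} (hf : DifferentiableOn ℂ f U) :
    ContinuousOn (fderiv ℂ f) U := by
  rw [continuousOn_clm_apply]
  intro v z0 hz0
  apply ContinuousAt.continuousWithinAt
  have : ProperSpace E := FiniteDimensional.proper ℂ E
  obtain ⟨r0, hr0, hr0U⟩ := Metric.isOpen_iff.1 hU z0 hz0
  set r := r0 / 4 with hr
  have hrpos : 0 < r := by positivity
  have hsub : closedBall z0 (2 * r) ⊆ U := (closedBall_subset_ball (by rw [hr]; linarith)).trans hr0U
  have huc : UniformContinuousOn f (closedBall z0 (2 * r)) :=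
    (isCompact_closedBall z0 (2 * r)).uniformContinuousOn_of_continuous
      (hf.continuousOn.mono hsub)
  rw [Metric.continuousAt_iff]
  intro ε hε
  set ρ := r / (‖v‖ + 1) with hρ
  have hρpos : 0 < ρ := by positivity
  obtain ⟨η, hη, hηu⟩ := Metric.uniformContinuousOn_iff.1 huc (ε * ρ / 2) (by positivity)
  refine ⟨min r η, lt_min hrpos hη, ?_⟩
  intro z hz
  have hzr : dist z z0 < r := lt_of_lt_of_le hz (min_le_left _ _)
  have hzη : dist z z0 < η := lt_of_lt_of_le hz (min_le_right _ _)
  have hnorm : ∀ s : ℂ, s ∈ closedBall (0:ℂ) ρ → ‖s • v‖ ≤ r := by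
    intro s hs
    rw [mem_closedBall_zero_iff] at hs
    rw [norm_smul]
    calc ‖s‖ * ‖v‖ ≤ ρ * (‖v‖ + 1) := by gcongr; linarith
      _ = r := by rw [hρ]; field_simp
  have hmem : ∀ w : E, dist w z0 ≤ r → ∀ s ∈ closedBall (0:ℂ) ρ, w + s • v ∈ closedBall z0 (2*r) := by
    intro w hw s hs
    rw [mem_closedBall, dist_eq_norm]
    have := hnorm s hs
    rw [dist_eq_norm] at hw
    calc ‖w + s • v - z0‖ = ‖(w - z0) + s • v‖ := by congr 1; abel
      _ ≤ ‖w - z0‖ + ‖s • v‖ := norm_add_le _ _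
      _ ≤ 2 * r := by linarith
  have hline : ∀ w : E, dist w z0 ≤ r → ∀ s ∈ closedBall (0:ℂ) ρ,
      HasDerivAt (fun s : ℂ => f (w + s • v)) (fderiv ℂ f (w + s • v) v) s := by
    intro w hw s hs
    have h1 : HasFDerivAt f (fderiv ℂ f (w + s • v)) (w + s • v) :=
      ((hf _ (hsub (hmem w hw s hs))).differentiableAt
        (hU.mem_nhds (hsub (hmem w hw s hs)))).hasFDerivAt
    have h2 : HasDerivAt (fun s : ℂ => w + s • v) v s := by
      simpa using ((hasDerivAt_id s).smul_const v).const_add w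
    exact h1.comp_hasDerivAt s h2
  have h0 : (0:ℂ) ∈ closedBall (0:ℂ) ρ := by simp [hρpos.le]
  have hder : deriv (fun s : ℂ => f (z + s • v) - f (z0 + s • v)) 0
      = fderiv ℂ f z v - fderiv ℂ f z0 v := by
    have := ((hline z hzr.le 0 h0).sub (hline z0 (by simp [hrpos.le]) 0 h0)).deriv
    simp only [zero_smul, add_zero] at this
    exact this
  have hest : ‖deriv (fun s : ℂ => f (z + s • v) - f (z0 + s • v)) 0‖ ≤ (ε * ρ / 2) / ρ := by
    apply Complex.norm_deriv_le_of_forall_mem_sphere_norm_le hρpos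
    · apply DifferentiableOn.diffContOnCl
      rw [closure_ball _ hρpos.ne']
      intro s hs
      exact ((hline z hzr.le s hs).sub
        (hline z0 (by simp [hrpos.le]) s hs)).differentiableAt.differentiableWithinAt
    · intro s hs
      have hs' := sphere_subset_closedBall hs
      have := hηu _ (hmem z hzr.le s hs') _ (hmem z0 (by simp [hrpos.le]) s hs') (by simpa using hzη)
      rw [dist_eq_norm] at this
      exact this.le
  rw [dist_eq_norm, ← hder]
  calc _ ≤ _ := hest
    _ = ε / 2 := by field_simp
    _ < ε := by linarith

lemma holo_strict {E F : Type*} [NormedAddCommGroup E] [NormedSpace ℂ E]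
    [FiniteDimensional ℂ E] [NormedAddCommGroup F] [NormedSpace ℂ F]
    {U : Set E} (hU : IsOpen U) {f : E → F} (hf : DifferentiableOn ℂ f U) {z : E} (hz : z ∈ U) :
    HasStrictFDerivAt f (fderiv ℂ f z) z := by
  apply hasStrictFDerivAt_of_hasFDerivAt_of_continuousAt
  · filter_upwards [hU.mem_nhds hz] with y hy
    exact ((hf y hy).differentiableAt (hU.mem_nhds hy)).hasFDerivAt
  · exact (holo_continuousOn_fderiv hU hf).continuousAt (hU.mem_nhds hz)

lemma differentiableAt_circleIntegral {E : Type*} [NormedAddCommGroup E] [NormedSpace ℂ E]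
    [FiniteDimensional ℂ E] {O : Set (E × ℂ)} (hO : IsOpen O) {G : E × ℂ → ℂ}
    (hG : DifferentiableOn ℂ G O) {p0 : E} {c : ℂ} {R : ℝ} (hR : 0 ≤ R)
    (hsub : ∀ s ∈ sphere c R, (p0, s) ∈ O) :
    DifferentiableAt ℂ (fun p => ∮ s in C(c, R), G (p, s)) p0 := by
  have : ProperSpace E := FiniteDimensional.proper ℂ E
  have hcs : ({p0} : Set E) ×ˢ sphere c R ⊆ O := by
    rintro ⟨a, b⟩ ⟨ha, hb⟩
    rw [mem_singleton_iff] at ha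
    subst ha
    exact hsub b hb
  obtain ⟨u, v, hu, hv, hpu, hsv, huv⟩ :=
    generalized_tube_lemma isCompact_singleton (isCompact_sphere c R) hO hcs
  obtain ⟨ε, hε, hεu⟩ := Metric.nhds_basis_closedBall.mem_iff.1 (hu.mem_nhds (hpu rfl))
  have hin : closedBall p0 ε ×ˢ sphere c R ⊆ O := (prod_mono hεu hsv).trans huv
  have hinn : ∀ x ∈ closedBall p0 ε, ∀ θ : ℝ, (x, circleMap c R θ) ∈ O := fun x hx θ =>
    hin ⟨hx, circleMap_mem_sphere c hR θ⟩
  have hGc := hG.continuousOn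
  have hG'c := holo_continuousOn_fderiv hO hG
  have hcomp : IsCompact (closedBall p0 ε ×ˢ sphere c R) :=
    (isCompact_closedBall p0 ε).prod (isCompact_sphere c R)
  obtain ⟨M, hM⟩ := hcomp.exists_bound_of_continuousOn (hG'c.mono hin)
  simp only [circleIntegral]
  have hpc : ∀ x ∈ closedBall p0 ε, Continuous (fun θ : ℝ => G (x, circleMap c R θ)) := by
    intro x hx
    exact hGc.comp_continuous (by fun_prop) (hinn x hx)
  have hder : Continuous (deriv (circleMap c R)) := by
    have : deriv (circleMap c R) = fun θ => circleMap 0 R θ * Complex.I := by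
      funext θ; simp
    rw [this]; fun_prop
  have hp0 : p0 ∈ closedBall p0 ε := mem_closedBall_self hε.le
  have key := intervalIntegral.hasFDerivAt_integral_of_dominated_of_fderiv_le (𝕜 := ℂ) (μ := volume)
    (a := 0) (b := 2 * Real.pi) (x₀ := p0) (s := ball p0 ε)
    (F := fun p θ => deriv (circleMap c R) θ • G (p, circleMap c R θ))
    (F' := fun p θ => deriv (circleMap c R) θ •
      (fderiv ℂ G (p, circleMap c R θ)).comp (ContinuousLinearMap.inl ℂ E ℂ))
    (bound := fun _ => |R| * (M * ‖ContinuousLinearMap.inl ℂ E ℂ‖))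
    (ball_mem_nhds p0 hε) ?_ ?_ ?_ ?_ ?_ ?_
  · exact key.differentiableAt
  · filter_upwards [closedBall_mem_nhds p0 hε] with x hx
    exact (hder.smul (hpc x hx)).aestronglyMeasurable
  · exact (hder.smul (hpc p0 hp0)).intervalIntegrable _ _
  · apply Continuous.aestronglyMeasurable
    apply hder.smul
    have : Continuous (fun θ : ℝ => fderiv ℂ G (p0, circleMap c R θ)) :=
      hG'c.comp_continuous (by fun_prop) (hinn p0 hp0)
    exact this.clm_comp continuous_const
  · refine Eventually.of_forall fun θ _ x hx => ?_
    rw [norm_smul]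
    have h1 : ‖deriv (circleMap c R) θ‖ = |R| := by simp
    rw [h1]
    gcongr
    refine (ContinuousLinearMap.opNorm_comp_le _ _).trans ?_
    gcongr
    exact hM _ ⟨ball_subset_closedBall hx, circleMap_mem_sphere c hR θ⟩
  · exact intervalIntegrable_const
  · refine Eventually.of_forall fun θ _ x hx => ?_
    have hmem := hinn x (ball_subset_closedBall hx) θ
    have h1 : HasFDerivAt G (fderiv ℂ G (x, circleMap c R θ)) (x, circleMap c R θ) :=
      ((hG _ hmem).differentiableAt (hO.mem_nhds hmem)).hasFDerivAt
    have h2 : HasFDerivAt (fun y : E => (y, circleMap c R θ)) (ContinuousLinearMap.inl ℂ E ℂ) x :=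
      hasFDerivAt_prodMk_left x _
    exact (h1.comp x h2).const_smul (deriv (circleMap c R) θ)

/-- The partial derivative in the last variable is holomorphic. -/
lemma differentiableOn_deriv_snd {E : Type*} [NormedAddCommGroup E] [NormedSpace ℂ E]
    [FiniteDimensional ℂ E] {O : Set (E × ℂ)} (hO : IsOpen O) {f : E × ℂ → ℂ}
    (hf : DifferentiableOn ℂ f O) :
    DifferentiableOn ℂ (fun p : E × ℂ => deriv (fun s => f (p.1, s)) p.2) O := by
  rintro ⟨y0, t0⟩ hp
  apply DifferentiableAt.differentiableWithinAt
  obtain ⟨ε, hε, hsub⟩ := Metric.nhds_basis_closedBall.mem_iff.1 (hO.mem_nhds hp)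
  rw [← closedBall_prod_same] at hsub
  -- slice
  have hslice : ∀ y ∈ ball y0 ε, DifferentiableOn ℂ (fun s => f (y, s)) {s | (y, s) ∈ O} := by
    intro y hy s hs
    have h1 := (hf (y, s) hs).differentiableAt (hO.mem_nhds hs)
    have h2 : DifferentiableAt ℂ (fun s : ℂ => (y, s)) s := by fun_prop
    exact (DifferentiableAt.comp s (g := f) (f := fun s : ℂ => (y, s)) h1 h2).differentiableWithinAt
  have hopen : ∀ y, IsOpen {s | (y, s) ∈ O} := fun y => hO.preimage (by fun_prop)
  have heq : (fun p : E × ℂ => deriv (fun s => f (p.1, s)) p.2) =ᶠ[𝓝 (y0, t0)]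
      fun p => (2 * Real.pi * Complex.I : ℂ)⁻¹ • ∮ z in C(t0, ε), ((z - p.2) ^ 2)⁻¹ • f (p.1, z) := by
    have : ball y0 ε ×ˢ ball t0 ε ∈ 𝓝 (y0, t0) :=
      prod_mem_nhds (ball_mem_nhds _ hε) (ball_mem_nhds _ hε)
    filter_upwards [this] with p hp'
    exact (Complex.two_pi_I_inv_smul_circleIntegral_sub_sq_inv_smul_of_differentiable
      (hopen p.1) (fun z hz => hsub ⟨ball_subset_closedBall hp'.1, hz⟩) (hslice p.1 hp'.1)
      hp'.2).symm
  refine DifferentiableAt.congr_of_eventuallyEq ?_ heq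
  suffices hh : DifferentiableAt ℂ
      (fun p : E × ℂ => ∮ z in C(t0, ε), ((z - p.2) ^ 2)⁻¹ • f (p.1, z)) (y0, t0) from
    hh.const_smul (2 * Real.pi * Complex.I : ℂ)⁻¹
  have hO' : IsOpen {q : (E × ℂ) × ℂ | (q.1.1, q.2) ∈ O ∧ q.2 - q.1.2 ≠ 0} := by
    apply IsOpen.and
    · exact hO.preimage (by fun_prop)
    · exact isOpen_ne_fun (by fun_prop) (by fun_prop)
  refine differentiableAt_circleIntegral hO'
    (G := fun q : (E × ℂ) × ℂ => ((q.2 - q.1.2) ^ 2)⁻¹ • f (q.1.1, q.2)) ?_ hε.le ?_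
  · intro q hq
    apply DifferentiableAt.differentiableWithinAt
    apply DifferentiableAt.fun_smul
    · apply DifferentiableAt.fun_inv
      · fun_prop
      · exact pow_ne_zero 2 hq.2
    · exact DifferentiableAt.comp q (g := f) (f := fun q : (E × ℂ) × ℂ => (q.1.1, q.2))
        ((hf _ hq.1).differentiableAt (hO.mem_nhds hq.1)) (by fun_prop)
  · intro s hs
    refine ⟨hsub ⟨mem_closedBall_self hε.le, sphere_subset_closedBall hs⟩, ?_⟩
    rw [mem_sphere, dist_eq_norm] at hs
    intro h
    simp only [h, norm_zero] at hs
    linarith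

lemma differentiableOn_iteratedDeriv_snd {E : Type*} [NormedAddCommGroup E] [NormedSpace ℂ E]
    [FiniteDimensional ℂ E] {O : Set (E × ℂ)} (hO : IsOpen O) {f : E × ℂ → ℂ}
    (hf : DifferentiableOn ℂ f O) (k : ℕ) :
    DifferentiableOn ℂ (fun p : E × ℂ => iteratedDeriv k (fun s => f (p.1, s)) p.2) O := by
  induction k with
  | zero => simpa using hf
  | succ k ih =>
    have := differentiableOn_deriv_snd hO ih
    simpa [iteratedDeriv_succ] using this

end AnSet

namespace AnSet
open Metric Set Filter Topology

lemma not_eventually_zero {f : ℂ → ℂ} {c : ℂ} {R : ℝ} (hR : 0 < R)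
    (hf : AnalyticOnNhd ℂ f (closedBall c R)) (hne : ∀ z ∈ sphere c R, f z ≠ 0)
    {a : ℂ} (ha : a ∈ closedBall c R) : ¬ ∀ᶠ z in 𝓝 a, f z = 0 := by
  intro h
  have h1 := hf.eqOn_zero_of_preconnected_of_eventuallyEq_zero
    (convex_closedBall c R).isPreconnected ha h
  have h2 : c + R ∈ sphere c R := by simp [hR.le]
  exact hne _ h2 (h1 (sphere_subset_closedBall h2))

lemma finite_zeros {f : ℂ → ℂ} {c : ℂ} {R : ℝ} (hR : 0 < R)
    (hf : AnalyticOnNhd ℂ f (closedBall c R)) (hne : ∀ z ∈ sphere c R, f z ≠ 0) :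
    {z ∈ closedBall c R | f z = 0}.Finite := by
  by_contra hinf
  obtain ⟨x, hx, hacc⟩ := Set.Infinite.exists_accPt_of_subset_isCompact hinf
    (isCompact_closedBall c R) (fun z hz => hz.1)
  rw [accPt_iff_frequently_nhdsNE] at hacc
  rcases (hf x hx).eventually_eq_zero_or_eventually_ne_zero with h | h
  · exact not_eventually_zero hR hf hne hx h
  · exact hacc (h.mono fun z hz hz' => hz hz'.2)

lemma exists_factor_aux {c : ℂ} {R : ℝ} (hR : 0 < R) (n : ℕ) : ∀ f : ℂ → ℂ, 
    AnalyticOnNhd ℂ f (closedBall c R) → (∀ z ∈ sphere c R, f z ≠ 0) →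
    {z ∈ closedBall c R | f z = 0}.ncard = n →
    ∃ s : Multiset ℂ, (∀ a ∈ s, a ∈ ball c R) ∧ ∃ g : ℂ → ℂ, AnalyticOnNhd ℂ g (closedBall c R) ∧
      (∀ z ∈ closedBall c R, g z ≠ 0) ∧ ∀ z, f z = (s.map (fun a => z - a)).prod * g z := by
  induction n with
  | zero =>
    intro f hf hne hn
    rw [Set.ncard_eq_zero (finite_zeros hR hf hne)] at hn
    refine ⟨0, by simp, f, hf, ?_, by simp⟩
    intro z hz h0
    have : z ∈ {z ∈ closedBall c R | f z = 0} := ⟨hz, h0⟩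
    rw [hn] at this
    exact this
  | succ n ih =>
    intro f hf hne hn
    have hnon : {z ∈ closedBall c R | f z = 0}.Nonempty := by
      rw [← Set.ncard_pos (finite_zeros hR hf hne)]; omega
    obtain ⟨a, ha, hfa⟩ := hnon
    obtain ⟨m, g0, hg0, hg0a, hfg⟩ :=
      ((hf a ha).exists_eventuallyEq_pow_smul_nonzero_iff).2 (not_eventually_zero hR hf hne ha)
    have hm : m ≠ 0 := by
      rintro rfl
      have := hfg.self_of_nhds
      simp [hfa] at this
      exact hg0a this.symm
    have hab : a ∈ ball c R := by
      by_contra hnb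
      exact hne a (by rw [← closedBall_sdiff_ball]; exact ⟨ha, hnb⟩) hfa
    classical
    set g : ℂ → ℂ := Function.update (fun z => f z / (z - a) ^ m) a (g0 a) with hg
    have hgne : ∀ z, z ≠ a → g z = f z / (z - a) ^ m := fun z hz => by
      simp [hg, Function.update_of_ne hz]
    have hga : g a = g0 a := by simp [hg]
    have hfeq : ∀ z, f z = (z - a) ^ m * g z := by
      intro z
      by_cases hz : z = a
      · subst hz; simp [hfa, hm]
      · rw [hgne z hz]
        have : (z - a) ^ m ≠ 0 := pow_ne_zero _ (sub_ne_zero.2 hz)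
        field_simp
    have hgan : AnalyticOnNhd ℂ g (closedBall c R) := by
      intro z hz
      by_cases hza : z = a
      · subst hza
        refine hg0.congr ?_
        filter_upwards [hfg] with w hw
        by_cases hwz : w = z
        · rw [hwz, hga]
        · have : (w - z) ^ m ≠ 0 := pow_ne_zero _ (sub_ne_zero.2 hwz)
          rw [hgne w hwz, hw, smul_eq_mul]
          field_simp
      · have h1 : AnalyticAt ℂ (fun z => f z / (z - a) ^ m) z :=
          (hf z hz).div (by fun_prop) (pow_ne_zero _ (sub_ne_zero.2 hza))
        refine h1.congr ?_
        filter_upwards [isOpen_ne.mem_nhds hza] with w hw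
        exact (hgne w hw).symm
    have hgs : ∀ z ∈ sphere c R, g z ≠ 0 := by
      intro z hz h0
      apply hne z hz
      rw [hfeq z, h0, mul_zero]
    have hset : {z ∈ closedBall c R | g z = 0} = {z ∈ closedBall c R | f z = 0} \ {a} := by
      ext z
      simp only [mem_ofPred_eq, Set.mem_sdiff, mem_singleton_iff]
      constructor
      · rintro ⟨h1, h2⟩
        refine ⟨⟨h1, by rw [hfeq, h2, mul_zero]⟩, ?_⟩
        rintro rfl
        rw [hga] at h2
        exact hg0a h2
      · rintro ⟨⟨h1, h2⟩, h3⟩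
        refine ⟨h1, ?_⟩
        rw [hgne z h3, h2, zero_div]
    obtain ⟨s, hs, g1, hg1, hg1ne, hg1eq⟩ := ih g hgan hgs (by
      rw [hset, Set.ncard_sdiff_singleton_of_mem (show a ∈ {z | z ∈ closedBall c R ∧ f z = 0} from
        ⟨ha, hfa⟩), hn]; rfl)
    refine ⟨Multiset.replicate m a + s, ?_, g1, hg1, hg1ne, ?_⟩
    · intro b hb
      rcases Multiset.mem_add.1 hb with h | h
      · rw [Multiset.eq_of_mem_replicate h]; exact hab
      · exact hs b h
    · intro z
      rw [hfeq z, hg1eq z]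
      simp [mul_assoc]

lemma analyticAt_multiset_prod (s : Multiset ℂ) (z : ℂ) :
    AnalyticAt ℂ (fun z => (s.map (fun a => z - a)).prod) z := by
  induction s using Multiset.induction_on with
  | empty => simp only [Multiset.map_zero, Multiset.prod_zero]; fun_prop
  | cons b s ih =>
    simp only [Multiset.map_cons, Multiset.prod_cons]
    exact AnalyticAt.mul (by fun_prop) ih

lemma circle_log {c : ℂ} {R : ℝ} (hR : 0 < R) {g h : ℂ → ℂ}
    (hg : AnalyticOnNhd ℂ g (closedBall c R)) (hgne : ∀ z ∈ closedBall c R, g z ≠ 0)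
    (hh : AnalyticOnNhd ℂ h (closedBall c R)) (s : Multiset ℂ) (hs : ∀ a ∈ s, a ∈ ball c R) :
    CircleIntegrable (fun z => h z * logDeriv (fun z => (s.map (fun a => z - a)).prod * g z) z) c R ∧
    ∮ z in C(c, R), h z * logDeriv (fun z => (s.map (fun a => z - a)).prod * g z) z
      = 2 * Real.pi * Complex.I * (s.map h).sum := by
  induction s using Multiset.induction_on with
  | empty =>
    have han : AnalyticOnNhd ℂ (fun z => h z * logDeriv g z) (closedBall c R) := fun z hz =>
      (hh z hz).mul ((hg z hz).deriv.div (hg z hz) (hgne z hz))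
    have hd : DifferentiableOn ℂ (fun z => h z * logDeriv g z) (closedBall c R) :=
      han.differentiableOn
    simp only [Multiset.map_zero, Multiset.prod_zero, one_mul, Multiset.sum_zero, mul_zero]
    refine ⟨(hd.continuousOn.mono sphere_subset_closedBall).circleIntegrable hR.le, ?_⟩
    exact (DifferentiableOn.diffContOnCl (by rwa [closure_ball _ hR.ne'])).circleIntegral_eq_zero hR.le
  | cons a s ih =>
    have hsa := hs a (Multiset.mem_cons_self a s)
    obtain ⟨ihi, ihe⟩ := ih (fun b hb => hs b (Multiset.mem_cons_of_mem hb))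
    have hsp : ∀ z ∈ sphere c R, ∀ b ∈ ball c R, z - b ≠ 0 := by
      intro z hz b hb h
      rw [sub_eq_zero] at h
      subst h
      rw [mem_sphere] at hz
      rw [mem_ball] at hb
      linarith
    have hlog : ∀ z ∈ sphere c R,
        h z * logDeriv (fun z => ((a ::ₘ s).map (fun a => z - a)).prod * g z) z
        = (z - a)⁻¹ • h z + h z * logDeriv (fun z => (s.map (fun a => z - a)).prod * g z) z := by
      intro z hz
      have hz' := sphere_subset_closedBall hz
      simp only [Multiset.map_cons, Multiset.prod_cons, mul_assoc]
      rw [logDeriv_mul (f := fun z => z - a)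
        (g := fun z => (s.map (fun a => z - a)).prod * g z) z (hsp z hz a hsa) ?_
        (by fun_prop) ((analyticAt_multiset_prod s z).mul (hg z hz')).differentiableAt]
      · have : logDeriv (fun z => z - a) z = (z - a)⁻¹ := by
          simp [logDeriv_apply]
        rw [this, smul_eq_mul]
        ring
      · refine mul_ne_zero ?_ (hgne z hz')
        rw [Ne, Multiset.prod_eq_zero_iff]
        simp only [Multiset.mem_map, not_exists, not_and]
        intro b hb
        exact hsp z hz b (hs b (Multiset.mem_cons_of_mem hb))
    have hhd : DifferentiableOn ℂ h (closedBall c R) := hh.differentiableOn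
    have hci : CircleIntegrable (fun z => (z - a)⁻¹ • h z) c R := by
      apply ContinuousOn.circleIntegrable hR.le
      apply ContinuousOn.fun_smul
      · apply ContinuousOn.inv₀ (by fun_prop)
        intro z hz
        exact hsp z hz a hsa
      · exact hhd.continuousOn.mono sphere_subset_closedBall
    have hval : ∮ z in C(c, R), (z - a)⁻¹ • h z = (2 * Real.pi * Complex.I) • h a :=
      hhd.circleIntegral_sub_inv_smul hsa
    constructor
    · refine (hci.add ihi).congr ?_
      intro z hz
      exact (hlog _ (circleMap_mem_sphere c hR.le z)).symm
    · rw [circleIntegral.integral_congr hR.le hlog, circleIntegral.integral_add hci ihi, hval, ihe]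
      simp [mul_add]

/-- Argument principle: zeros with multiplicity in a disc. -/
lemma arg_principle {c : ℂ} {R : ℝ} (hR : 0 < R) {f : ℂ → ℂ}
    (hf : AnalyticOnNhd ℂ f (closedBall c R)) (hne : ∀ z ∈ sphere c R, f z ≠ 0) :
    ∃ s : Multiset ℂ, (∀ a ∈ s, a ∈ ball c R) ∧ (∀ z ∈ closedBall c R, f z = 0 ↔ z ∈ s) ∧
      (∀ a, 2 ≤ s.count a → deriv f a = 0) ∧
      ∀ h : ℂ → ℂ, AnalyticOnNhd ℂ h (closedBall c R) →
        ∮ z in C(c, R), h z * (deriv f z / f z) = 2 * Real.pi * Complex.I * (s.map h).sum := by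
  obtain ⟨s, hs, g, hg, hgne, hfg⟩ := exists_factor_aux hR _ f hf hne rfl
  refine ⟨s, hs, ?_, ?_, ?_⟩
  rotate_left
  · intro a ha
    have hle : Multiset.replicate 2 a ≤ s := Multiset.le_count_iff_replicate_le.1 ha
    obtain ⟨u, hu⟩ := Multiset.le_iff_exists_add.1 hle
    have hamem : a ∈ s := Multiset.count_pos.1 (by omega)
    have haR := hs a hamem
    have hfe : f = fun z => (z - a) * ((z - a) * ((u.map (fun a => z - a)).prod * g z)) := by
      funext z
      rw [hfg z, hu]
      simp [mul_assoc]
    have hG : DifferentiableAt ℂ (fun z => (u.map (fun a => z - a)).prod * g z) a :=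
      ((analyticAt_multiset_prod u a).mul (hg a (ball_subset_closedBall haR))).differentiableAt
    have h1 : HasDerivAt (fun z : ℂ => z - a) 1 a := (hasDerivAt_id a).sub_const a
    have h2 := h1.mul (h1.mul hG.hasDerivAt)
    have h3 : HasDerivAt f 0 a := by
      rw [hfe]
      refine h2.congr_deriv ?_
      simp
    exact h3.deriv
  rotate_right
  · intro z hz
    rw [hfg z, mul_eq_zero, or_iff_left (hgne z hz), Multiset.prod_eq_zero_iff]
    simp only [Multiset.mem_map, sub_eq_zero]
    constructor
    · rintro ⟨a, ha, rfl⟩; exact ha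
    · intro h; exact ⟨z, h, rfl⟩
  · intro h hh
    have := (circle_log hR hg hgne hh s hs).2
    rw [← this, ← funext hfg]
    rfl

/-- Newton's identities: elementary symmetric functions of holomorphic families are holomorphic
if the power sums are. -/
lemma differentiableOn_prod_of_psum {E : Type*} [NormedAddCommGroup E] [NormedSpace ℂ E]
    {U : Set E} {d : ℕ} {x : E → Fin d → ℂ}
    (hp : ∀ m : ℕ, DifferentiableOn ℂ (fun y => ∑ i, x y i ^ m) U) :
    DifferentiableOn ℂ (fun y => ∏ i, x y i) U := by
  have key : ∀ k : ℕ, DifferentiableOn ℂ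
      (fun y => MvPolynomial.aeval (x y) (MvPolynomial.esymm (Fin d) ℂ k)) U := by
    intro k
    induction k using Nat.strong_induction_on with
    | _ k ih =>
      rcases Nat.eq_zero_or_pos k with rfl | hk
      · simp only [MvPolynomial.esymm_zero, map_one]; fun_prop
      · have heq : (fun y => MvPolynomial.aeval (x y) (MvPolynomial.esymm (Fin d) ℂ k)) =
            fun y => (k : ℂ)⁻¹ * ((-1) ^ (k + 1) * ∑ a ∈ Finset.HasAntidiagonal.antidiagonal k with a.1 < k,
              (-1) ^ a.1 * MvPolynomial.aeval (x y) (MvPolynomial.esymm (Fin d) ℂ a.1) *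
                ∑ i, x y i ^ a.2) := by
          funext y
          have h := congrArg (MvPolynomial.aeval (x y)) (MvPolynomial.mul_esymm_eq_sum (Fin d) ℂ k)
          simp only [map_mul, map_sum, map_pow, map_neg, map_one, map_natCast,
            MvPolynomial.psum, MvPolynomial.aeval_X] at h
          rw [← h, ← mul_assoc, inv_mul_cancel₀ (by exact_mod_cast hk.ne'), one_mul]
        rw [heq]
        apply DifferentiableOn.const_mul
        apply DifferentiableOn.const_mul
        apply DifferentiableOn.fun_sum
        intro a ha
        rw [Finset.mem_filter] at ha
        exact ((ih a.1 ha.2).const_mul _).mul (hp a.2)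
  have := key d
  convert this using 2 with y
  rw [MvPolynomial.esymm]
  have : Finset.powersetCard d (Finset.univ : Finset (Fin d)) = {Finset.univ} := by
    have h := Finset.powersetCard_self (Finset.univ : Finset (Fin d))
    rwa [Finset.card_fin] at h
  simp [this]

end AnSet

namespace AnSet
open Metric Set Filter Topology

lemma exists_polydisc {H : Type*} [NormedAddCommGroup H] [NormedSpace ℂ H]
    {O : Set (H × ℂ)} (hO : IsOpen O) {f : H × ℂ → ℂ}
    (hf : DifferentiableOn ℂ f O) {y0 : H} {t0 : ℂ} (hp : (y0, t0) ∈ O)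
    (hnz : ¬ ∀ᶠ t in 𝓝 t0, f (y0, t) = 0) {r : ℝ} (hr : 0 < r) :
    ∃ R δ : ℝ, 0 < R ∧ R < r ∧ 0 < δ ∧ δ < r ∧ ball y0 δ ×ˢ closedBall t0 R ⊆ O ∧
      (∀ y ∈ ball y0 δ, ∀ t ∈ sphere t0 R, f (y, t) ≠ 0) ∧
      ∀ t ∈ closedBall t0 R, f (y0, t) = 0 → t = t0 := by
  have hcont : Continuous (fun t : ℂ => (y0, t)) := by fun_prop
  have hO1 : IsOpen ((fun t : ℂ => (y0, t)) ⁻¹' O) := hO.preimage hcont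
  have hg : DifferentiableOn ℂ (fun t => f (y0, t)) ((fun t : ℂ => (y0, t)) ⁻¹' O) :=
    hf.comp (by fun_prop) (fun t ht => ht)
  have han : AnalyticAt ℂ (fun t => f (y0, t)) t0 := hg.analyticAt (hO1.mem_nhds hp)
  have hne := han.eventually_eq_zero_or_eventually_ne_zero.resolve_left hnz
  rw [eventually_nhdsWithin_iff] at hne
  obtain ⟨ε, hε, hsub⟩ := Metric.mem_nhds_iff.1 (hne.and (hO1.mem_nhds hp))
  set R := min ε r / 2 with hR
  have hR0 : 0 < R := by positivity
  have hRε : R < ε := by have := min_le_left ε r; have : 0 < min ε r := by positivity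
                         linarith
  have hRr : R < r := by have := min_le_right ε r; have : 0 < min ε r := by positivity
                         linarith
  have hcb : ∀ t ∈ closedBall t0 R, t ∈ ball t0 ε := closedBall_subset_ball hRε
  have hT1 : ({y0} : Set H) ×ˢ closedBall t0 R ⊆ O := by
    rintro ⟨y, t⟩ ⟨hy, ht⟩
    obtain rfl : y = y0 := hy
    exact (hsub (hcb t ht)).2
  have hO2 : IsOpen (O ∩ f ⁻¹' {0}ᶜ) := hf.continuousOn.isOpen_inter_preimage hO isOpen_compl_singleton
  have hT2 : ({y0} : Set H) ×ˢ sphere t0 R ⊆ O ∩ f ⁻¹' {0}ᶜ := by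
    rintro ⟨y, t⟩ ⟨hy, ht⟩
    obtain rfl : y = y0 := hy
    have := hsub (hcb t (sphere_subset_closedBall ht))
    refine ⟨this.2, this.1 ?_⟩
    rintro rfl
    simp at ht
    linarith
  obtain ⟨u, v, hu, -, hyu, hv, huv⟩ :=
    generalized_tube_lemma isCompact_singleton (isCompact_closedBall t0 R) hO hT1
  obtain ⟨u', v', hu', -, hyu', hv', huv'⟩ :=
    generalized_tube_lemma isCompact_singleton (isCompact_sphere t0 R) hO2 hT2
  obtain ⟨δ, hδ, hδs⟩ := Metric.mem_nhds_iff.1 (inter_mem (hu.mem_nhds (hyu rfl)) (hu'.mem_nhds (hyu' rfl)))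
  have hb : ball y0 (min δ (r/2)) ⊆ ball y0 δ := ball_subset_ball (min_le_left _ _)
  refine ⟨R, min δ (r/2), hR0, hRr, by positivity, ?_, ?_, ?_, ?_⟩
  · have := min_le_right δ (r/2); linarith
  · rintro ⟨y, t⟩ ⟨hy, ht⟩
    exact huv ⟨(hδs (hb hy)).1, hv ht⟩
  · intro y hy t ht
    exact (huv' ⟨(hδs (hb hy)).2, hv' ht⟩ : (y, t) ∈ O ∩ f ⁻¹' {0}ᶜ).2
  · intro t ht h0
    by_contra hne
    exact (hsub (hcb t ht)).1 hne h0

/-- Holomorphic families of roots. -/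
lemma roots_family {H : Type*} [NormedAddCommGroup H] [NormedSpace ℂ H] [FiniteDimensional ℂ H]
    {O : Set (H × ℂ)} (hO : IsOpen O) {f : H × ℂ → ℂ}
    (hf : DifferentiableOn ℂ f O) {y0 : H} {t0 : ℂ} {R δ : ℝ} (hR : 0 < R) (hδ : 0 < δ)
    (hsub : ball y0 δ ×ˢ closedBall t0 R ⊆ O)
    (hne : ∀ y ∈ ball y0 δ, ∀ t ∈ sphere t0 R, f (y, t) ≠ 0) :
    ∃ (d : ℕ) (x : H → Fin d → ℂ), 
      (∀ y ∈ ball y0 δ, (∀ i, x y i ∈ ball t0 R) ∧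
        (∀ t ∈ closedBall t0 R, f (y, t) = 0 ↔ ∃ i, x y i = t) ∧
        (∀ i j, i ≠ j → x y i = x y j → deriv (fun t => f (y, t)) (x y i) = 0)) ∧
      ∀ h : H × ℂ → ℂ, DifferentiableOn ℂ h O → 
        DifferentiableOn ℂ (fun y => ∑ i, h (y, x y i)) (ball y0 δ) := by
  have hslice : ∀ h : H × ℂ → ℂ, DifferentiableOn ℂ h O → ∀ y ∈ ball y0 δ,
      AnalyticOnNhd ℂ (fun t => h (y, t)) (closedBall t0 R) := by
    intro h hh y hy t ht
    have hO1 : IsOpen ((fun t : ℂ => (y, t)) ⁻¹' O) := hO.preimage (by fun_prop)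
    have hg : DifferentiableOn ℂ (fun t => h (y, t)) ((fun t : ℂ => (y, t)) ⁻¹' O) :=
      hh.comp (by fun_prop) (fun t ht => ht)
    exact hg.analyticAt (hO1.mem_nhds (hsub ⟨hy, ht⟩))
  have hex : ∀ y : H, ∃ s : Multiset ℂ, y ∈ ball y0 δ → ((∀ a ∈ s, a ∈ ball t0 R) ∧
      (∀ z ∈ closedBall t0 R, f (y, z) = 0 ↔ z ∈ s) ∧
      (∀ a, 2 ≤ s.count a → deriv (fun t => f (y, t)) a = 0) ∧
      ∀ h : ℂ → ℂ, AnalyticOnNhd ℂ h (closedBall t0 R) →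
        ∮ z in C(t0, R), h z * (deriv (fun t => f (y, t)) z / f (y, z))
          = 2 * Real.pi * Complex.I * (s.map h).sum) := by
    intro y
    by_cases hy : y ∈ ball y0 δ
    · obtain ⟨s, hs⟩ := arg_principle hR (hslice f hf y hy) (hne y hy)
      exact ⟨s, fun _ => hs⟩
    · exact ⟨0, fun h => absurd h hy⟩
  choose s hs using hex
  have h2pi : (2 * Real.pi * Complex.I : ℂ) ≠ 0 := Complex.two_pi_I_ne_zero
  have hdiff : ∀ h : H × ℂ → ℂ, DifferentiableOn ℂ h O →
      DifferentiableOn ℂ (fun y => ((s y).map (fun t => h (y, t))).sum) (ball y0 δ) := by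
    intro h hh
    have hO2 : IsOpen (O ∩ f ⁻¹' {0}ᶜ) :=
      hf.continuousOn.isOpen_inter_preimage hO isOpen_compl_singleton
    have hG : DifferentiableOn ℂ
        (fun p : H × ℂ => h p * (deriv (fun s => f (p.1, s)) p.2 / f p)) (O ∩ f ⁻¹' {0}ᶜ) := by
      apply (hh.mono inter_subset_left).mul
      simp only [div_eq_mul_inv]
      refine ((differentiableOn_deriv_snd hO hf).mono inter_subset_left).mul ?_
      exact DifferentiableOn.fun_inv (hf.mono inter_subset_left) (fun p hp => hp.2)
    have h1 : DifferentiableOn ℂ (fun y => (2 * Real.pi * Complex.I : ℂ)⁻¹ *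
        ∮ z in C(t0, R), h (y, z) * (deriv (fun t => f (y, t)) z / f (y, z))) (ball y0 δ) := by
      intro y hy
      apply DifferentiableAt.differentiableWithinAt
      apply DifferentiableAt.const_mul
      exact differentiableAt_circleIntegral hO2 hG hR.le (fun z hz =>
        ⟨hsub ⟨hy, sphere_subset_closedBall hz⟩, hne y hy z hz⟩)
    refine h1.congr ?_
    intro y hy
    rw [(hs y hy).2.2.2 _ (hslice h hh y hy), ← mul_assoc, inv_mul_cancel₀ h2pi, one_mul]
  have hcard : ∀ y ∈ ball y0 δ, (s y).card = (s y0).card := by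
    have hc : ContinuousOn (fun y => ((s y).card : ℂ)) (ball y0 δ) := by
      have := (hdiff (fun _ => 1) (by fun_prop)).continuousOn
      simpa using this
    have hc2 : ContinuousOn (fun y => (s y).card) (ball y0 δ) := by
      have he : IsClosedEmbedding (fun n : ℕ => (n : ℂ)) := by
        have := Nat.isClosedEmbedding_coe_real
        exact (Complex.isometry_ofReal.isClosedEmbedding.comp this)
      exact he.isInducing.continuousOn_iff.2 hc
    have hpre : IsPreconnected (ball y0 δ) := by
      let _ : NormedSpace ℝ H := NormedSpace.restrictScalars ℝ ℂ H
      exact (convex_ball y0 δ).isPreconnected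
    intro y hy
    exact hpre.constant_of_mapsTo (T := univ) (isDiscrete_univ_iff.2 inferInstance) hc2 (fun _ _ => mem_univ _) hy (mem_ball_self hδ)
  set d := (s y0).card with hd
  have hx : ∀ y : H, ∃ x : Fin d → ℂ, y ∈ ball y0 δ → Multiset.map x Finset.univ.val = s y := by
    intro y
    by_cases hy : y ∈ ball y0 δ
    · have hl : (s y).toList.length = d := by rw [Multiset.length_toList, hcard y hy]
      refine ⟨fun i => (s y).toList.get (i.cast hl.symm), fun _ => ?_⟩
      have : List.ofFn (fun i : Fin d => (s y).toList.get (i.cast hl.symm)) = (s y).toList := by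
        conv_rhs => rw [← List.ofFn_get (s y).toList]
        exact (List.ofFn_congr hl _).symm
      have h3 := congrArg (fun l : List ℂ => (l : Multiset ℂ)) this
      simp only [Multiset.coe_toList] at h3
      rw [← Fin.univ_val_map] at h3
      exact h3
    · exact ⟨fun _ => 0, fun h => absurd h hy⟩
  choose x hx using hx
  have hmem : ∀ y ∈ ball y0 δ, ∀ a, a ∈ s y ↔ ∃ i, x y i = a := by
    intro y hy a
    rw [← hx y hy]
    simp
  refine ⟨d, x, ?_, ?_⟩
  · intro y hy
    refine ⟨fun i => (hs y hy).1 _ ((hmem y hy _).2 ⟨i, rfl⟩), fun t ht => ?_, ?_⟩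
    · rw [(hs y hy).2.1 t ht, hmem y hy]
    · intro i j hij he
      apply (hs y hy).2.2.1
      rw [← hx y hy, Multiset.le_count_iff_replicate_le]
      have h1 : ({i, j} : Finset (Fin d)).val ≤ Finset.univ.val := Finset.val_le_iff.2 (Finset.subset_univ _)
      have h2 := Multiset.map_le_map (f := x y) h1
      refine le_trans (le_of_eq ?_) h2
      rw [Finset.insert_val_of_notMem (by simpa using hij)]
      simp [he, Multiset.replicate_succ]
  · intro h hh
    refine (hdiff h hh).congr ?_
    intro y hy
    simp only [← hx y hy, Multiset.map_map]
    rfl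

end AnSet

namespace AnSet
open Metric Set Filter Topology

lemma graph_at {H : Type*} [NormedAddCommGroup H] [NormedSpace ℂ H] [FiniteDimensional ℂ H]
    {O : Set (H × ℂ)} (hO : IsOpen O) {f : H × ℂ → ℂ}
    (hf : DifferentiableOn ℂ f O) {y0 : H} {t0 : ℂ} (hp : (y0, t0) ∈ O) (hf0 : f (y0, t0) = 0)
    (hd : deriv (fun t => f (y0, t)) t0 ≠ 0) :
    ∃ V ∈ 𝓝 (y0, t0), ∃ (W : Set H) (φ : H → ℂ), IsOpen W ∧ DifferentiableOn ℂ φ W ∧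
      ∀ q ∈ V, f q = 0 → q.1 ∈ W ∧ q.2 = φ q.1 := by
  have hnz : ¬ ∀ᶠ t in 𝓝 t0, f (y0, t) = 0 := by
    intro h
    apply hd
    have : (fun t => f (y0, t)) =ᶠ[𝓝 t0] fun _ => 0 := h
    rw [this.deriv_eq]
    simp
  obtain ⟨R, δ, hR, -, hδ, -, hsub, hne, huniq⟩ := exists_polydisc hO hf hp hnz one_pos
  obtain ⟨d, x, hx, hdiff⟩ := roots_family hO hf hR hδ hsub hne
  have hy0 : y0 ∈ ball y0 δ := mem_ball_self hδ
  obtain ⟨h1, h2, h3⟩ := hx y0 hy0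
  have hall : ∀ i, x y0 i = t0 := fun i =>
    huniq _ (ball_subset_closedBall (h1 i)) ((h2 _ (ball_subset_closedBall (h1 i))).2 ⟨i, rfl⟩)
  obtain ⟨i0, -⟩ := (h2 t0 (mem_closedBall_self hR.le)).1 hf0
  have hsing : ∀ i, i = i0 := by
    intro i
    by_contra hne
    have := h3 i i0 hne (by rw [hall, hall])
    rw [hall] at this
    exact hd this
  refine ⟨ball y0 δ ×ˢ ball t0 R, prod_mem_nhds (ball_mem_nhds _ hδ) (ball_mem_nhds _ hR),
    ball y0 δ, fun y => ∑ i, x y i, isOpen_ball, hdiff (fun p => p.2) (by fun_prop), ?_⟩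
  rintro ⟨y, t⟩ ⟨hy, ht⟩ hq
  refine ⟨hy, ?_⟩
  obtain ⟨i, hi⟩ := ((hx y hy).2.1 t (ball_subset_closedBall ht)).1 hq
  have : (Finset.univ : Finset (Fin d)) = {i0} := by
    ext i; simp [hsing i]
  simp only [this, Finset.sum_singleton]
  rw [← hi, hsing i]

lemma graphs {H : Type*} [NormedAddCommGroup H] [NormedSpace ℂ H] [FiniteDimensional ℂ H]
    {O : Set (H × ℂ)} (hO : IsOpen O) {f : H × ℂ → ℂ}
    (hf : DifferentiableOn ℂ f O) {A : Set (H × ℂ)} (hA : A ⊆ O)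
    (hA2 : ∀ p ∈ A, f p = 0 ∧ ¬ ∀ᶠ t in 𝓝 p.2, f (p.1, t) = 0) :
    ∃ Gam : Set (Set H × (H → ℂ)), Gam.Countable ∧ (∀ g ∈ Gam, IsOpen g.1 ∧ DifferentiableOn ℂ g.2 g.1) ∧
      ∀ p ∈ A, ∃ g ∈ Gam, p.1 ∈ g.1 ∧ p.2 = g.2 p.1 := by
  have : ProperSpace H := FiniteDimensional.proper ℂ H
  have hm : ∀ m : ℕ, ∃ Gam : Set (Set H × (H → ℂ)), Gam.Countable ∧
      (∀ g ∈ Gam, IsOpen g.1 ∧ DifferentiableOn ℂ g.2 g.1) ∧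
      ∀ p ∈ A, iteratedDeriv m (fun s => f (p.1, s)) p.2 = 0 → 
        iteratedDeriv (m+1) (fun s => f (p.1, s)) p.2 ≠ 0 → ∃ g ∈ Gam, p.1 ∈ g.1 ∧ p.2 = g.2 p.1 := by
    intro m
    set F : H × ℂ → ℂ := fun p => iteratedDeriv m (fun s => f (p.1, s)) p.2 with hF
    have hFd : DifferentiableOn ℂ F O := differentiableOn_iteratedDeriv_snd hO hf m
    set B : Set (H × ℂ) := {p ∈ A | F p = 0 ∧ iteratedDeriv (m+1) (fun s => f (p.1, s)) p.2 ≠ 0} with hB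
    have hex : ∀ p : H × ℂ, ∃ (V : Set (H × ℂ)) (g : Set H × (H → ℂ)), p ∈ B → 
        (V ∈ 𝓝 p ∧ IsOpen g.1 ∧ DifferentiableOn ℂ g.2 g.1 ∧
          ∀ q ∈ V, F q = 0 → q.1 ∈ g.1 ∧ q.2 = g.2 q.1) := by
      intro p
      by_cases hp : p ∈ B
      · obtain ⟨V, hV, W, φ, h⟩ := graph_at hO hFd (y0 := p.1) (t0 := p.2) (hA hp.1) hp.2.1 (by
          have := hp.2.2
          rw [iteratedDeriv_succ] at this
          exact this)
        exact ⟨V, (W, φ), fun _ => ⟨hV, h⟩⟩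
      · exact ⟨∅, (∅, fun _ => 0), fun h => absurd h hp⟩
    choose V g hg using hex
    obtain ⟨T, hTB, hTc, hcov⟩ := TopologicalSpace.countable_cover_nhdsWithin (s := B) (f := V)
      (fun p hp => mem_nhdsWithin_of_mem_nhds (hg p hp).1)
    refine ⟨g '' T, hTc.image g, ?_, ?_⟩
    · rintro _ ⟨p, hp, rfl⟩
      exact ⟨(hg p (hTB hp)).2.1, (hg p (hTB hp)).2.2.1⟩
    · intro p hp h1 h2
      obtain ⟨q, hq, hpq⟩ := mem_iUnion₂.1 (hcov (⟨hp, h1, h2⟩ : p ∈ B))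
      exact ⟨g q, mem_image_of_mem g hq, (hg q (hTB hq)).2.2.2 p hpq h1⟩
  choose Gam hGamc hGam hGamA using hm
  refine ⟨⋃ m, Gam m, countable_iUnion hGamc, ?_, ?_⟩
  · intro g hg
    obtain ⟨m, hm⟩ := mem_iUnion.1 hg
    exact hGam m g hm
  · intro p hp
    have hO1 : IsOpen ((fun t : ℂ => (p.1, t)) ⁻¹' O) := hO.preimage (by fun_prop)
    have hg : DifferentiableOn ℂ (fun t => f (p.1, t)) ((fun t : ℂ => (p.1, t)) ⁻¹' O) :=
      hf.comp (by fun_prop) (fun t ht => ht)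
    have han : AnalyticAt ℂ (fun t => f (p.1, t)) p.2 := hg.analyticAt (hO1.mem_nhds (hA hp))
    have hex : ∃ k, iteratedDeriv k (fun s => f (p.1, s)) p.2 ≠ 0 := by
      by_contra hcon
      push Not at hcon
      apply (hA2 p hp).2
      rw [← analyticOrderAt_eq_top, ENat.eq_top_iff_forall_ge]
      intro m
      rw [natCast_le_analyticOrderAt_iff_iteratedDeriv_eq_zero han]
      intro i _
      exact hcon i
    classical
    have hk := Nat.find_spec hex
    have hmin := fun m => Nat.find_min (m := m) hex
    set k := Nat.find hex
    have hk0 : k ≠ 0 := by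
      intro h0
      rw [h0] at hk
      exact hk (by simpa using (hA2 p hp).1)
    obtain ⟨m, hm⟩ := Nat.exists_eq_succ_of_ne_zero hk0
    have h1 := hmin m (by omega)
    push Not at h1
    obtain ⟨g, hg, h⟩ := hGamA m p hp h1 (by rw [hm] at hk; exact hk)
    exact ⟨g, mem_iUnion.2 ⟨m, hg⟩, h⟩

/-- `X ∩ U` is cut out by holomorphic functions on `U`. -/
def Cut {E : Type*} [NormedAddCommGroup E] [NormedSpace ℂ E] (X U : Set E) : Prop :=
  ∀ z ∈ U, z ∉ X → ∃ h : E → ℂ, DifferentiableOn ℂ h U ∧ (∀ x ∈ X ∩ U, h x = 0) ∧ h z ≠ 0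

lemma exists_nonvanish {E : Type*} (P : (E → ℂ) → Prop) (h0 : P 0)
    (hadd : ∀ f g : E → ℂ, ∀ c : ℂ, P f → P g → P (f + c • g)) (s : Finset E)
    (hs : ∀ z ∈ s, ∃ h, P h ∧ h z ≠ 0) : ∃ h, P h ∧ ∀ z ∈ s, h z ≠ 0 := by
  classical
  induction s using Finset.induction_on with
  | empty => exact ⟨0, h0, by simp⟩
  | insert a s ha ih =>
    obtain ⟨f, hf, hfs⟩ := ih (fun z hz => hs z (Finset.mem_insert_of_mem hz))
    obtain ⟨g, hg, hga⟩ := hs a (Finset.mem_insert_self a s)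
    obtain ⟨c, hc⟩ := Infinite.exists_notMem_finset ((insert a s).image (fun z => - f z / g z))
    refine ⟨f + c • g, hadd f g c hf hg, ?_⟩
    intro z hz h
    simp only [Pi.add_apply, Pi.smul_apply, smul_eq_mul] at h
    by_cases hgz : g z = 0
    · rcases Finset.mem_insert.1 hz with rfl | hz'
      · exact hga hgz
      · exact hfs z hz' (by simpa [hgz] using h)
    · apply hc
      rw [Finset.mem_image]
      refine ⟨z, hz, ?_⟩
      field_simp
      linear_combination -h

lemma elim {H : Type*} [NormedAddCommGroup H] [NormedSpace ℂ H] [FiniteDimensional ℂ H]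
    {X U : Set (H × ℂ)} (hU : IsOpen U) (h0 : (0 : H × ℂ) ∈ U) (hcut : Cut X U)
    {f : H × ℂ → ℂ} (hf : DifferentiableOn ℂ f U) (hfX : ∀ x ∈ X ∩ U, f x = 0)
    (hnz : ¬ ∀ᶠ t in 𝓝 (0 : ℂ), f (0, t) = 0) :
    ∃ (ρ δ : ℝ) (d : ℕ), 0 < ρ ∧ 0 < δ ∧ ball (0 : H) δ ×ˢ closedBall (0 : ℂ) ρ ⊆ U ∧
      Cut {y | ∃ t ∈ ball (0 : ℂ) ρ, (y, t) ∈ X} (ball (0 : H) δ) ∧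
      (∀ y ∈ ball (0 : H) δ, ∃ s : Finset ℂ, s.card ≤ d ∧ ∀ t ∈ ball (0 : ℂ) ρ, (y, t) ∈ X → t ∈ s) ∧
      ∃ Gam : Set (Set H × (H → ℂ)), Gam.Countable ∧
        (∀ g ∈ Gam, IsOpen g.1 ∧ DifferentiableOn ℂ g.2 g.1) ∧
        ∀ y ∈ ball (0 : H) δ, ∀ t ∈ ball (0 : ℂ) ρ, (y, t) ∈ X → 
          ∃ g ∈ Gam, y ∈ g.1 ∧ t = g.2 y := by
  classical
  obtain ⟨R, δ, hR, -, hδ, -, hsub, hne, huniq⟩ := exists_polydisc hU hf h0 hnz one_pos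
  obtain ⟨d, x, hx, hdiff⟩ := roots_family hU hf hR hδ hsub hne
  have hmemU : ∀ y ∈ ball (0 : H) δ, ∀ t ∈ ball (0 : ℂ) R, (y, t) ∈ U := fun y hy t ht =>
    hsub ⟨hy, ball_subset_closedBall ht⟩
  refine ⟨R, δ, d, hR, hδ, hsub, ?_, ?_, ?_⟩
  · intro y hy hyX
    have hroot := (hx y hy).1
    obtain ⟨h, ⟨hhd, hhX⟩, hhne⟩ := exists_nonvanish
      (fun h => DifferentiableOn ℂ h U ∧ ∀ x ∈ X ∩ U, h x = 0)
      ⟨differentiableOn_const 0, fun _ _ => rfl⟩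
      (fun f g c hf hg => ⟨hf.1.add (hg.1.const_smul c), fun x hx => by simp [hf.2 x hx, hg.2 x hx]⟩)
      (Finset.univ.image (fun i => (y, x y i))) (by
        intro z hz
        obtain ⟨i, -, rfl⟩ := Finset.mem_image.1 hz
        obtain ⟨h, h1, h2, h3⟩ := hcut (y, x y i) (hmemU y hy _ (hroot i)) (fun hc =>
          hyX ⟨x y i, hroot i, hc⟩)
        exact ⟨h, ⟨h1, h2⟩, h3⟩)
    refine ⟨fun y => ∏ i, h (y, x y i), ?_, ?_, ?_⟩
    · apply differentiableOn_prod_of_psum (x := fun y i => h (y, x y i))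
      intro m
      exact hdiff (fun p => h p ^ m) (hhd.pow m)
    · rintro y' ⟨⟨t, ht, htX⟩, hy'⟩
      have hU' := hmemU y' hy' t ht
      obtain ⟨i, hi⟩ := ((hx y' hy').2.1 t (ball_subset_closedBall ht)).1 (hfX _ ⟨htX, hU'⟩)
      apply Finset.prod_eq_zero (Finset.mem_univ i)
      rw [hi]
      exact hhX _ ⟨htX, hU'⟩
    · rw [Finset.prod_ne_zero_iff]
      intro i _
      exact hhne _ (Finset.mem_image_of_mem _ (Finset.mem_univ i))
  · intro y hy
    refine ⟨Finset.univ.image (x y), Finset.card_image_le.trans (by simp), ?_⟩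
    intro t ht htX
    obtain ⟨i, hi⟩ := ((hx y hy).2.1 t (ball_subset_closedBall ht)).1 (hfX _ ⟨htX, hmemU y hy t ht⟩)
    exact Finset.mem_image.2 ⟨i, Finset.mem_univ _, hi⟩
  · set A : Set (H × ℂ) := {p | p.1 ∈ ball (0 : H) δ ∧ p.2 ∈ ball (0 : ℂ) R ∧ p ∈ X} with hA
    obtain ⟨Gam, h1, h2, h3⟩ := graphs hU hf (A := A) (fun p hp => hmemU _ hp.1 _ hp.2.1) (by
      intro p hp
      refine ⟨hfX p ⟨hp.2.2, hmemU _ hp.1 _ hp.2.1⟩, ?_⟩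
      have hO1 : IsOpen ((fun t : ℂ => (p.1, t)) ⁻¹' U) := hU.preimage (by fun_prop)
      have hg : DifferentiableOn ℂ (fun t => f (p.1, t)) ((fun t : ℂ => (p.1, t)) ⁻¹' U) :=
        hf.comp (by fun_prop) (fun t ht => ht)
      exact not_eventually_zero hR (f := fun t => f (p.1, t)) (c := 0)
        (fun t ht => hg.analyticAt (hO1.mem_nhds (hsub ⟨hp.1, ht⟩))) (hne p.1 hp.1)
        (ball_subset_closedBall hp.2.1))
    exact ⟨Gam, h1, h2, fun y hy t ht hX => h3 (y, t) ⟨hy, ht, hX⟩⟩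

end AnSet

namespace AnSet
open Metric Set Filter Topology

lemma line_zero {E : Type*} [NormedAddCommGroup E] [NormedSpace ℂ E]
    {r : ℝ} {f : E → ℂ} (hf : DifferentiableOn ℂ f (ball 0 r)) {p v : E}
    (hp : p ∈ ball (0 : E) r) (h : ∀ᶠ t in 𝓝 (0 : ℂ), f (p + t • v) = 0) {t : ℂ}
    (ht : p + t • v ∈ ball (0 : E) r) : f (p + t • v) = 0 := by
  have hc : Continuous (fun t : ℂ => p + t • v) := by fun_prop
  have hO : IsOpen ((fun t : ℂ => p + t • v) ⁻¹' ball 0 r) := isOpen_ball.preimage hc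
  have hd : DifferentiableOn ℂ (fun t : ℂ => f (p + t • v)) ((fun t : ℂ => p + t • v) ⁻¹' ball 0 r) :=
    hf.comp (by fun_prop) (fun t ht => ht)
  have hpre : IsPreconnected ((fun t : ℂ => p + t • v) ⁻¹' ball 0 r) := by
    let _ : NormedSpace ℝ E := NormedSpace.restrictScalars ℝ ℂ E
    have : IsScalarTower ℝ ℂ E := IsScalarTower.restrictScalars ℝ ℂ E
    have h1 : Convex ℝ ((fun t : ℂ => p + t • v) ⁻¹' ball 0 r) := by
      intro a ha b hb x y hx hy hxy
      have := convex_ball (0 : E) r ha hb hx hy hxy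
      rw [mem_preimage]
      convert this using 1
      rw [smul_add, smul_add, add_smul, add_add_add_comm, ← add_smul x y p, hxy, one_smul,
        smul_assoc, smul_assoc]
    exact h1.isPreconnected
  exact (hd.analyticOnNhd hO).eqOn_zero_of_preconnected_of_eventuallyEq_zero hpre
    (by simpa using hp) h ht

lemma exists_direction {E : Type*} [NormedAddCommGroup E] [NormedSpace ℂ E]
    {r : ℝ} (hr : 0 < r) {f : E → ℂ} (hf : DifferentiableOn ℂ f (ball 0 r)) {z1 : E}
    (hz1 : z1 ∈ ball (0 : E) r) (hfz : f z1 ≠ 0) {v0 : E} {V : Set E} (hV : V ∈ 𝓝 v0) :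
    ∃ v ∈ V, ¬ ∀ᶠ t in 𝓝 (0 : ℂ), f (t • v) = 0 := by
  by_contra! hcon
  obtain ⟨c, hc0, hcb⟩ : ∃ c : ℂ, c ≠ 0 ∧ c • v0 ∈ ball (0 : E) r := by
    have hc : Tendsto (fun c : ℂ => c • v0) (𝓝[≠] 0) (𝓝 0) := by
      have : Continuous (fun c : ℂ => c • v0) := by fun_prop
      have := (this.tendsto 0).mono_left (nhdsWithin_le_nhds (s := {0}ᶜ))
      simpa using this
    obtain ⟨c, h1, h2⟩ := ((hc.eventually (ball_mem_nhds 0 hr)).and self_mem_nhdsWithin).exists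
    exact ⟨c, h2, h1⟩
  have hlocal : ∀ᶠ z in 𝓝 (c • v0), f z = 0 := by
    have h1 : Tendsto (fun z => c⁻¹ • z) (𝓝 (c • v0)) (𝓝 v0) := by
      have : Continuous (fun z : E => c⁻¹ • z) := by fun_prop
      have := this.tendsto (c • v0)
      simpa [smul_smul, inv_mul_cancel₀ hc0] using this
    filter_upwards [h1 hV, isOpen_ball.mem_nhds hcb] with z hz hzb
    have hz' := hcon _ hz
    have := line_zero hf (p := 0) (v := c⁻¹ • z) (t := c) (mem_ball_self hr) (by simpa using hz')
      (by simpa [smul_smul, mul_inv_cancel₀ hc0] using hzb)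
    simpa [smul_smul, mul_inv_cancel₀ hc0] using this
  apply hfz
  have h3 : Tendsto (fun t : ℂ => c • v0 + t • (z1 - c • v0)) (𝓝 0) (𝓝 (c • v0)) := by
    have : Continuous (fun t : ℂ => c • v0 + t • (z1 - c • v0)) := by fun_prop
    have := this.tendsto 0
    simpa using this
  have := line_zero hf (p := c • v0) (v := z1 - c • v0) (t := 1) hcb (h3.eventually hlocal)
    (by simpa using hz1)
  simpa using this

lemma exists_notMem {E : Type} [NormedAddCommGroup E] [NormedSpace ℂ E] [FiniteDimensional ℂ E]
    {n : ℕ} (hn : n < Module.finrank ℂ E) {X : Set E} {r : ℝ} (hr : 0 < r)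
    (hdim : dimH (X ∩ ball 0 r) ≤ (2 * n : ℕ)) : ∃ z ∈ ball (0 : E) r, z ∉ X := by
  by_contra! hcon
  let _ : NormedSpace ℝ E := NormedSpace.restrictScalars ℝ ℂ E
  have : IsScalarTower ℝ ℂ E := IsScalarTower.restrictScalars ℝ ℂ E
  have : FiniteDimensional ℝ E := FiniteDimensional.trans ℝ ℂ E
  have h1 : X ∩ ball 0 r = ball 0 r := inter_eq_right.2 hcon
  rw [h1, Real.dimH_of_mem_nhds (ball_mem_nhds 0 hr), finrank_real_of_complex] at hdim
  have : 2 * Module.finrank ℂ E ≤ 2 * n := by exact_mod_cast hdim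
  omega


/-- Good projections: finite fibres and covering by holomorphic graphs. -/
def Good {n : ℕ} {E : Type} [NormedAddCommGroup E] [NormedSpace ℂ E] (X : Set E)
    (L : E →L[ℂ] (Fin n → ℂ)) (ρ : ℝ) (M : ℕ) : Prop :=
  (∀ w, ∃ s : Finset E, s.card ≤ M ∧ ∀ z ∈ X ∩ ball 0 ρ, L z = w → z ∈ s) ∧
  ∃ Gam : Set (Set (Fin n → ℂ) × ((Fin n → ℂ) → E)), Gam.Countable ∧
    (∀ g ∈ Gam, IsOpen g.1 ∧ DifferentiableOn ℂ g.2 g.1 ∧ ∀ w ∈ g.1, L (g.2 w) = w) ∧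
    ∀ z ∈ X ∩ ball 0 ρ, ∃ g ∈ Gam, L z ∈ g.1 ∧ g.2 (L z) = z

lemma noether_base {n : ℕ} {E : Type} [NormedAddCommGroup E] [NormedSpace ℂ E]
    [FiniteDimensional ℂ E] (hE : Module.finrank ℂ E = n) (X : Set E)
    (L : E →L[ℂ] (Fin n → ℂ)) (hL : Function.Surjective L) (ρ : ℝ) : Good X L ρ 1 := by
  have hinj : Function.Injective (L : E →ₗ[ℂ] (Fin n → ℂ)) :=
    (LinearMap.injective_iff_surjective_of_finrank_eq_finrank (by simp [hE])).2 hL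
  let e := (LinearEquiv.ofBijective (L : E →ₗ[ℂ] (Fin n → ℂ)) ⟨hinj, hL⟩).toContinuousLinearEquiv
  have he : ∀ z, e z = L z := fun z => rfl
  refine ⟨?_, {(univ, fun w => e.symm w)}, countable_singleton _, ?_, ?_⟩
  · intro w
    refine ⟨{e.symm w}, by simp, ?_⟩
    intro z _ hz
    rw [Finset.mem_singleton, ← hz, ← he, e.symm_apply_apply]
  · rintro g rfl
    refine ⟨isOpen_univ, e.symm.differentiable.differentiableOn, fun w _ => ?_⟩
    rw [← he]
    exact e.apply_symm_apply w
  · intro z _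
    refine ⟨_, rfl, mem_univ _, ?_⟩
    rw [← he]
    exact e.symm_apply_apply z

lemma noether {n : ℕ} (k : ℕ) : ∀ (E : Type) [NormedAddCommGroup E] [NormedSpace ℂ E]
    [FiniteDimensional ℂ E], Module.finrank ℂ E = n + k → ∀ (X : Set E) (r : ℝ), 0 < r →
    Cut X (ball 0 r) → dimH (X ∩ ball 0 r) ≤ (2 * n : ℕ) → ∀ L0 : E →L[ℂ] (Fin n → ℂ),
    Function.Surjective L0 → ∀ η : ℝ, 0 < η → 
    ∃ (L : E →L[ℂ] (Fin n → ℂ)) (ρ : ℝ) (M : ℕ), ‖L - L0‖ < η ∧ 0 < ρ ∧ ρ ≤ r ∧ Good X L ρ M := by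
  induction k with
  | zero =>
    intro E _ _ _ hE X r hr hcut hdim L0 hL0 η hη
    exact ⟨L0, r, 1, by simpa using hη, hr, le_rfl, noether_base hE X L0 hL0 r⟩
  | succ k ih =>
    intro E _ _ _ hE X r hr hcut hdim L0 hL0 η hη
    obtain ⟨z1, hz1, hz1X⟩ := exists_notMem (by omega) hr hdim
    obtain ⟨f, hf, hfX, hfz⟩ := hcut z1 hz1 hz1X
    obtain ⟨v0, hv0, hv0L⟩ : ∃ v0 : E, v0 ≠ 0 ∧ L0 v0 = 0 := by
      by_contra! hcon
      have hinj : Function.Injective (L0 : E →ₗ[ℂ] (Fin n → ℂ)) := by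
        rw [injective_iff_map_eq_zero]
        intro a ha
        by_contra hne
        exact hcon a hne ha
      have := LinearMap.finrank_le_finrank_of_injective hinj
      simp at this
      omega
    obtain ⟨l, hl⟩ := SeparatingDual.exists_eq_one (R := ℂ) hv0
    -- choice of the direction
    obtain ⟨v, hlv, hLv, hvf⟩ : ∃ v : E, l v = 1 ∧ ‖l‖ * ‖L0 v‖ < η / 2 ∧
        ¬ ∀ᶠ t in 𝓝 (0 : ℂ), f (t • v) = 0 := by
      have hlne : l v0 ≠ 0 := by rw [hl]; exact one_ne_zero
      have hcont : ContinuousAt (fun v : E => ‖l‖ * ‖L0 ((l v)⁻¹ • v)‖) v0 := by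
        have h1 : ContinuousAt (fun v : E => (l v)⁻¹) v0 := l.continuous.continuousAt.inv₀ hlne
        have h2 : ContinuousAt (fun v : E => (l v)⁻¹ • v) v0 := h1.fun_smul continuousAt_id
        exact continuousAt_const.mul ((L0.continuous.continuousAt.comp h2).norm)
      have hev1 : ∀ᶠ v in 𝓝 v0, ‖l‖ * ‖L0 ((l v)⁻¹ • v)‖ < η / 2 := by
        apply hcont.eventually_lt continuousAt_const
        simp [hv0L, hη]
      have hev2 : ∀ᶠ v in 𝓝 v0, l v ≠ 0 := l.continuous.continuousAt.eventually_ne hlne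
      obtain ⟨v, ⟨hv1, hv2⟩, hv3⟩ := exists_direction hr hf hz1 hfz (hev1.and hev2)
      refine ⟨(l v)⁻¹ • v, by simp [hv2], hv1, ?_⟩
      intro hcon
      apply hv3
      have : Tendsto (fun t : ℂ => t * l v) (𝓝 0) (𝓝 0) := by
        have : Continuous (fun t : ℂ => t * l v) := by fun_prop
        simpa using this.tendsto 0
      filter_upwards [this.eventually hcon] with t ht
      rwa [smul_smul, mul_assoc, mul_inv_cancel₀ hv2, mul_one] at ht
    set H : Submodule ℂ E := LinearMap.ker (l : E →ₗ[ℂ] ℂ) with hH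
    have hlH : ∀ y : H, l (y : E) = 0 := fun y => LinearMap.mem_ker.1 y.2
    let P : E →L[ℂ] H := (ContinuousLinearMap.id ℂ E - l.smulRight v).codRestrict H (by
      intro z
      rw [hH, LinearMap.mem_ker]
      simp [hlv])
    have hP : ∀ z, ((P z : H) : E) = z - l z • v := fun z => rfl
    let Ψ : H × ℂ →L[ℂ] E := H.subtypeL.comp (ContinuousLinearMap.fst ℂ H ℂ) +
      (ContinuousLinearMap.snd ℂ H ℂ).smulRight v
    have hΨ : ∀ y t, Ψ (y, t) = (y : E) + t • v := fun y t => rfl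
    have hΨP : ∀ z, Ψ (P z, l z) = z := fun z => by rw [hΨ, hP]; simp
    have hPΨ : ∀ y t, P (Ψ (y, t)) = y := fun y t => by
      apply Subtype.ext
      rw [hP, hΨ]; simp [hlv, hlH]
    have hlΨ : ∀ y t, l (Ψ (y, t)) = t := fun y t => by rw [hΨ]; simp [hlv, hlH]
    have hfin : Module.finrank ℂ H = n + k := by
      have h1 := LinearMap.finrank_range_add_finrank_ker (l : E →ₗ[ℂ] ℂ)
      have h2 : LinearMap.range (l : E →ₗ[ℂ] ℂ) = ⊤ := by
        rw [LinearMap.range_eq_top]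
        intro c
        exact ⟨c • v, by simp [hlv]⟩
      rw [h2, finrank_top, Module.finrank_self, hE] at h1
      change 1 + Module.finrank ℂ H = _ at h1
      omega
    have hsurj : Function.Surjective (L0.comp H.subtypeL) := by
      intro w
      obtain ⟨z, hz⟩ := hL0 w
      refine ⟨⟨z - l z • v0, by rw [hH, LinearMap.mem_ker]; simp [hl]⟩, ?_⟩
      simp [hv0L, hz]
    -- elimination
    obtain ⟨ρ1, δ, d, hρ1, hδ, hsub, hcut', hfib, Gam1, hGam1c, hGam1, hGam1X⟩ :=
      elim (X := Ψ ⁻¹' X) (U := Ψ ⁻¹' ball 0 r) (f := f ∘ Ψ) (isOpen_ball.preimage Ψ.continuous)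
        (by simp [hr]) (by
          intro z hz hzX
          obtain ⟨h, h1, h2, h3⟩ := hcut (Ψ z) hz hzX
          exact ⟨h ∘ Ψ, h1.comp Ψ.differentiable.differentiableOn (fun x hx => hx),
            fun x hx => h2 _ hx, h3⟩)
        (hf.comp Ψ.differentiable.differentiableOn (fun x hx => hx)) (fun x hx => hfX _ hx)
        (by simpa [hΨ] using hvf)
    set X' : Set H := {y | ∃ t ∈ ball (0 : ℂ) ρ1, (y, t) ∈ Ψ ⁻¹' X} with hX'
    have hdim' : dimH (X' ∩ ball 0 δ) ≤ (2 * n : ℕ) := by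
      have h1 : X' ∩ ball 0 δ ⊆ P '' (X ∩ ball 0 r) := by
        rintro y ⟨⟨t, ht, htX⟩, hy⟩
        exact ⟨Ψ (y, t), ⟨htX, hsub ⟨hy, ball_subset_closedBall ht⟩⟩, hPΨ y t⟩
      exact (dimH_mono h1).trans ((P.lipschitz.dimH_image_le _).trans hdim)
    obtain ⟨L', ρ', M, hL', hρ', hρδ, hfib', Gam', hGam'c, hGam', hGam'X⟩ :=
      ih H hfin X' δ hδ hcut' hdim' (L0.comp H.subtypeL) hsurj (η / 2 / (‖P‖ + 1)) (by positivity)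
    obtain ⟨ρ, hρ, hρs⟩ : ∃ ρ > 0, ∀ z ∈ ball (0 : E) ρ, P z ∈ ball (0 : H) ρ' ∧ l z ∈ ball (0 : ℂ) ρ1 := by
      have h1 : ∀ᶠ z in 𝓝 (0 : E), P z ∈ ball (0 : H) ρ' :=
        P.continuous.continuousAt.eventually_mem (by simpa using ball_mem_nhds (0 : H) hρ')
      have h2 : ∀ᶠ z in 𝓝 (0 : E), l z ∈ ball (0 : ℂ) ρ1 :=
        l.continuous.continuousAt.eventually_mem (by simpa using ball_mem_nhds (0 : ℂ) hρ1)
      exact Metric.mem_nhds_iff.1 (h1.and h2)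
    have hXX' : ∀ z ∈ X ∩ ball (0 : E) (min ρ r), P z ∈ X' ∩ ball 0 ρ' ∧ l z ∈ ball (0 : ℂ) ρ1 ∧
        (P z, l z) ∈ Ψ ⁻¹' X ∧ P z ∈ ball (0 : H) δ := by
      rintro z ⟨hzX, hz⟩
      have h1 := hρs z (ball_subset_ball (min_le_left _ _) hz)
      have h2 : (P z, l z) ∈ Ψ ⁻¹' X := by rw [mem_preimage, hΨP]; exact hzX
      exact ⟨⟨⟨l z, h1.2, h2⟩, h1.1⟩, h1.2, h2, ball_subset_ball hρδ h1.1⟩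
    refine ⟨L'.comp P, min ρ r, M * d, ?_, by positivity, min_le_right _ _, ?_, ?_⟩
    · have hb : ‖L'.comp P - L0‖ ≤ ‖L' - L0.comp H.subtypeL‖ * ‖P‖ + ‖l‖ * ‖L0 v‖ := by
        apply ContinuousLinearMap.opNorm_le_bound _ (by positivity)
        intro z
        have heq : (L'.comp P - L0) z = (L' - L0.comp H.subtypeL) (P z) - l z • L0 v := by
          simp only [sub_apply, ContinuousLinearMap.comp_apply,
            Submodule.subtypeL_apply, hP, map_sub, map_smul]
          abel
        rw [heq, add_mul]
        refine (norm_sub_le _ _).trans (add_le_add ?_ ?_)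
        · rw [mul_assoc]
          exact ((L' - L0.comp H.subtypeL).le_opNorm _).trans
            (mul_le_mul_of_nonneg_left (P.le_opNorm z) (norm_nonneg _))
        · rw [norm_smul]
          calc ‖l z‖ * ‖L0 v‖ ≤ (‖l‖ * ‖z‖) * ‖L0 v‖ := 
                mul_le_mul_of_nonneg_right (l.le_opNorm z) (norm_nonneg _)
            _ = ‖l‖ * ‖L0 v‖ * ‖z‖ := by ring
      have hb2 : ‖L' - L0.comp H.subtypeL‖ * ‖P‖ ≤ η / 2 := by
        calc ‖L' - L0.comp H.subtypeL‖ * ‖P‖ ≤ (η / 2 / (‖P‖ + 1)) * (‖P‖ + 1) := by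
              gcongr; linarith
          _ = η / 2 := by field_simp
      linarith
    · intro w
      classical
      obtain ⟨s, hs, hsm⟩ := hfib' w
      have hfib2 : ∀ y : H, ∃ s : Finset ℂ, s.card ≤ d ∧
          (y ∈ ball (0 : H) δ → ∀ t ∈ ball (0 : ℂ) ρ1, (y, t) ∈ Ψ ⁻¹' X → t ∈ s) := by
        intro y
        by_cases hy : y ∈ ball (0 : H) δ
        · obtain ⟨s, h1, h2⟩ := hfib y hy
          exact ⟨s, h1, fun _ => h2⟩
        · exact ⟨∅, by simp, fun h => absurd h hy⟩
      choose T hTc hT using hfib2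
      refine ⟨s.biUnion (fun y => (T y).image (fun t => Ψ (y, t))), ?_, ?_⟩
      · refine (Finset.card_biUnion_le_card_mul s _ d (fun y _ =>
          Finset.card_image_le.trans (hTc y))).trans ?_
        exact Nat.mul_le_mul_right d hs
      · intro z hz hzw
        obtain ⟨h1, h2, h3, h4⟩ := hXX' z hz
        rw [Finset.mem_biUnion]
        refine ⟨P z, hsm _ h1 hzw, ?_⟩
        rw [Finset.mem_image]
        exact ⟨l z, hT _ h4 _ h2 h3, hΨP z⟩
    · refine ⟨Set.image2 (fun g1 g' => (g'.1 ∩ g'.2 ⁻¹' g1.1, fun w => Ψ (g'.2 w, g1.2 (g'.2 w)))) Gam1 Gam',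
        hGam1c.image2 hGam'c _, ?_, ?_⟩
      · rintro _ ⟨g1, hg1, g', hg', rfl⟩
        obtain ⟨a1, a2⟩ := hGam1 g1 hg1
        obtain ⟨b1, b2, b3⟩ := hGam' g' hg'
        refine ⟨b2.continuousOn.isOpen_inter_preimage b1 a1, ?_, ?_⟩
        · apply Ψ.differentiable.comp_differentiableOn
          apply DifferentiableOn.prodMk
          · exact b2.mono inter_subset_left
          · exact a2.comp (b2.mono inter_subset_left) (fun w hw => hw.2)
        · intro w hw
          simp only [ContinuousLinearMap.comp_apply, hPΨ]
          exact b3 w hw.1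
      · intro z hz
        obtain ⟨h1, h2, h3, h4⟩ := hXX' z hz
        obtain ⟨g', hg', c1, c2⟩ := hGam'X _ h1
        obtain ⟨g1, hg1, d1, d2⟩ := hGam1X _ h4 _ h2 h3
        refine ⟨_, ⟨g1, hg1, g', hg', rfl⟩, ⟨c1, ?_⟩, ?_⟩
        · rw [mem_preimage]
          simp only [ContinuousLinearMap.comp_apply, c2]
          exact d1
        · simp only [ContinuousLinearMap.comp_apply, c2]
          rw [← d2, hΨP]

end AnSet

namespace AnSet
open Metric Set Filter Topology

/-- Coordinate projection. -/
noncomputable def proj {n N : ℕ} (I : Fin n → Fin N) : (Fin N → ℂ) →L[ℂ] (Fin n → ℂ) :=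
  ContinuousLinearMap.pi (fun i => ContinuousLinearMap.proj (I i))

lemma proj_surjective {n N : ℕ} {I : Fin n → Fin N} (hI : Function.Injective I) :
    Function.Surjective (proj I) := by
  intro w
  classical
  refine ⟨fun j => if h : ∃ i, I i = j then w h.choose else 0, ?_⟩
  funext i
  have h : ∃ i', I i' = I i := ⟨i, rfl⟩
  have : (proj I) (fun j => if h : ∃ i, I i = j then w h.choose else 0) i = w h.choose := by
    simp [proj]
  rw [this, hI h.choose_spec]

lemma exists_minor {n N : ℕ} (A : Matrix (Fin N) (Fin n) ℂ)
    (hA : Function.Injective A.mulVec) :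
    ∃ I : Fin n → Fin N, Function.Injective I ∧
      ∀ w, ‖A.mulVec w‖ ≤ n * ‖proj I (A.mulVec w)‖ := by
  classical
  -- existence of a nonzero minor
  obtain ⟨I1, hI1⟩ : ∃ I : Fin n → Fin N, (A.submatrix I id).det ≠ 0 := by
    have hrank : A.rank = n := by
      have : A.rank = Module.finrank ℂ (LinearMap.range A.mulVecLin) := rfl
      rw [this, LinearMap.finrank_range_of_inj hA]
      simp
    have hspan := A.rank_eq_finrank_span_row
    rw [hrank] at hspan
    obtain ⟨f, hf, -, hli⟩ := Submodule.exists_fun_fin_finrank_span_eq ℂ (Set.range A.row)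
    choose I hI using hf
    refine ⟨fun i => I (Fin.cast hspan i), ?_⟩
    have hli2 : LinearIndependent ℂ (fun i => f (Fin.cast hspan i)) :=
      hli.comp _ (Fin.cast_injective hspan)
    have : (A.submatrix (fun i => I (Fin.cast hspan i)) id).row = fun i => f (Fin.cast hspan i) := by
      funext i
      rw [← hI]
      rfl
    rw [← this, Matrix.linearIndependent_rows_iff_isUnit, Matrix.isUnit_iff_isUnit_det] at hli2
    exact hli2.ne_zero
  have : Nonempty (Fin n → Fin N) := ⟨I1⟩
  obtain ⟨I, hImax⟩ := Finite.exists_max (fun I : Fin n → Fin N => ‖(A.submatrix I id).det‖)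
  have hIpos : 0 < ‖(A.submatrix I id).det‖ := (norm_pos_iff.2 hI1).trans_le (hImax I1)
  refine ⟨I, ?_, ?_⟩
  · intro i j hij
    by_contra hne
    apply norm_pos_iff.1 hIpos
    apply Matrix.det_zero_of_row_eq hne
    funext k
    simp [hij]
  · intro w
    set B := A.submatrix I id with hB
    rw [pi_norm_le_iff_of_nonneg (by positivity)]
    intro j
    have hcr := Matrix.mulVec_cramer B.transpose (A j)
    have hrow : ∀ i, (B.transpose.cramer (A j)) i = (A.submatrix (Function.update I i j) id).det := by
      intro i
      rw [Matrix.cramer_transpose_apply]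
      congr 1
      ext a b
      by_cases hai : a = i
      · subst hai; simp
      · simp [hai, hB]
    have hsum : B.det * (A.mulVec w) j = ∑ i, (A.submatrix (Function.update I i j) id).det * (A.mulVec w) (I i) := by
      have h1 : ∀ k, B.det * A j k = ∑ i, (A.submatrix (Function.update I i j) id).det * A (I i) k := by
        intro k
        have := congrFun hcr k
        rw [Matrix.det_transpose, Pi.smul_apply, smul_eq_mul] at this
        rw [← this, Matrix.mulVec, dotProduct]
        refine Finset.sum_congr rfl fun i _ => ?_
        rw [hrow, mul_comm]
        rfl
      simp only [Matrix.mulVec, dotProduct, Finset.mul_sum]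
      rw [Finset.sum_comm]
      refine Finset.sum_congr rfl fun k _ => ?_
      rw [← mul_assoc, h1, Finset.sum_mul]
      refine Finset.sum_congr rfl fun i _ => by ring
    have hle : ‖B.det‖ * ‖(A.mulVec w) j‖ ≤ ‖B.det‖ * (n * ‖proj I (A.mulVec w)‖) := by
      rw [← norm_mul, hsum]
      refine (norm_sum_le _ _).trans ?_
      calc ∑ i, ‖(A.submatrix (Function.update I i j) id).det * (A.mulVec w) (I i)‖
          ≤ ∑ i : Fin n, ‖B.det‖ * ‖proj I (A.mulVec w)‖ := by
            refine Finset.sum_le_sum fun i _ => ?_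
            rw [norm_mul]
            refine mul_le_mul (hImax _) ?_ (norm_nonneg _) (norm_nonneg _)
            exact norm_le_pi_norm (proj I (A.mulVec w)) i
        _ = ‖B.det‖ * (n * ‖proj I (A.mulVec w)‖) := by simp; ring
    exact le_of_mul_le_mul_left hle hIpos

lemma exists_minor' {n N : ℕ} (A : (Fin n → ℂ) →L[ℂ] (Fin N → ℂ)) (hA : Function.Injective A) :
    ∃ I : Fin n → Fin N, Function.Injective I ∧ ∀ w, ‖A w‖ ≤ n * ‖proj I (A w)‖ := by
  have h : ∀ w, (LinearMap.toMatrix' (A : (Fin n → ℂ) →ₗ[ℂ] (Fin N → ℂ))).mulVec w = A w := fun w =>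
    LinearMap.toMatrix'_mulVec _ w
  obtain ⟨I, hI, hb⟩ := exists_minor (LinearMap.toMatrix' (A : (Fin n → ℂ) →ₗ[ℂ] (Fin N → ℂ))) (by
    rwa [funext h])
  exact ⟨I, hI, fun w => by rw [← h]; exact hb w⟩

set_option maxHeartbeats 2000000 in
/-- Local antilipschitz estimate on a graph piece. -/
lemma local_antilip {n N : ℕ} {W : Set (Fin n → ℂ)} (hW : IsOpen W) {Φ : (Fin n → ℂ) → (Fin N → ℂ)}
    (hΦ : DifferentiableOn ℂ Φ W) {L : (Fin N → ℂ) →L[ℂ] (Fin n → ℂ)} (hL : ∀ w ∈ W, L (Φ w) = w)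
    (LI : (Fin n → Fin N) → (Fin N → ℂ) →L[ℂ] (Fin n → ℂ))
    (hLI : ∀ I, Function.Injective I → ‖LI I - proj I‖ ≤ 1 / (2 * (n + 1))) {w0 : Fin n → ℂ} (hw0 : w0 ∈ W) :
    ∃ I : Fin n → Fin N, Function.Injective I ∧ ∃ V, IsOpen V ∧ w0 ∈ V ∧ V ⊆ W ∧ ∀ w ∈ V, ∀ w' ∈ V, 
      ‖Φ w - Φ w'‖ ≤ (4 * (n + 1)) * ‖LI I (Φ w) - LI I (Φ w')‖ := by
  have hs := holo_strict hW hΦ hw0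
  set A := fderiv ℂ Φ w0 with hA
  have hLA : ∀ w, L (A w) = w := by
    have h1 : HasFDerivAt (fun w => L (Φ w)) (L.comp A) w0 := L.hasFDerivAt.comp w0 hs.hasFDerivAt
    have h2 : HasFDerivAt (fun w => L (Φ w)) (ContinuousLinearMap.id ℂ _) w0 := by
      refine (hasFDerivAt_id w0).congr_of_eventuallyEq ?_
      filter_upwards [hW.mem_nhds hw0] with w hw using hL w hw
    intro w
    have := h1.unique h2
    exact DFunLike.congr_fun this w
  have hinj : Function.Injective A := fun a b hab => by rw [← hLA a, ← hLA b, hab]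
  obtain ⟨I, hI, hb⟩ := exists_minor' A hinj
  refine ⟨I, hI, ?_⟩
  set K : ℝ := (n : ℝ) + 1 with hK
  have hK0 : 0 < K := by positivity
  have hA2 : ∀ w, ‖A w‖ ≤ 2 * K * ‖LI I (A w)‖ := by
    intro w
    have h1 : ‖proj I (A w)‖ ≤ ‖LI I (A w)‖ + 1 / (2 * K) * ‖A w‖ := by
      have h2 : proj I (A w) = LI I (A w) - (LI I - proj I) (A w) := by simp
      rw [h2]
      refine (norm_sub_le _ _).trans (add_le_add_right ?_ _)
      exact ((LI I - proj I).le_opNorm _).trans (mul_le_mul_of_nonneg_right (hLI I hI) (norm_nonneg _))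
    have h3 : ‖A w‖ ≤ K * ‖proj I (A w)‖ := (hb w).trans (by rw [hK]; nlinarith [norm_nonneg (proj I (A w))])
    have h4 : K * ‖proj I (A w)‖ ≤ K * ‖LI I (A w)‖ + ‖A w‖ / 2 := by
      calc K * ‖proj I (A w)‖ ≤ K * (‖LI I (A w)‖ + 1 / (2 * K) * ‖A w‖) := by gcongr
        _ = _ := by field_simp
    linarith
  -- choose the size of the error
  set τ : ℝ := 1 / (2 * (2 * K * ‖LI I‖ + 1)) with hτ
  have hden : 0 < 2 * K * ‖LI I‖ + 1 := by positivity
  have hτ0 : 0 < τ := by positivity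
  have hc : 0 < τ / (‖L‖ + 1) := by positivity
  have hev := hs.isLittleO.def hc
  obtain ⟨V0, hV0o, hV0m, hV0⟩ : ∃ V0 : Set (Fin n → ℂ), IsOpen V0 ∧ w0 ∈ V0 ∧ ∀ w ∈ V0, ∀ w' ∈ V0,
      ‖Φ w - Φ w' - A (w - w')‖ ≤ τ / (‖L‖ + 1) * ‖w - w'‖ := by
    rw [nhds_prod_eq] at hev
    obtain ⟨t, ht, h⟩ := mem_prod_self_iff.1 hev
    obtain ⟨V, hVt, hVo, hV⟩ := _root_.mem_nhds_iff.1 ht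
    exact ⟨V, hVo, hV, fun w hw w' hw' =>
      h (show (w, w') ∈ t ×ˢ t from ⟨hVt hw, hVt hw'⟩)⟩
  refine ⟨V0 ∩ W, hV0o.inter hW, ⟨hV0m, hw0⟩, inter_subset_right, ?_⟩
  rintro w ⟨hw, hwW⟩ w' ⟨hw', hwW'⟩
  set D := Φ w - Φ w' with hD
  have h1 : ‖w - w'‖ ≤ ‖L‖ * ‖D‖ := by
    have : w - w' = L D := by rw [hD, map_sub, hL w hwW, hL w' hwW']
    rw [this]
    exact L.le_opNorm D
  have h2 : ‖D - A (w - w')‖ ≤ τ * ‖D‖ := by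
    refine (hV0 w hw w' hw').trans ?_
    calc τ / (‖L‖ + 1) * ‖w - w'‖ ≤ τ / (‖L‖ + 1) * ((‖L‖ + 1) * ‖D‖) := by
          gcongr
          exact h1.trans (by nlinarith [norm_nonneg D])
      _ = τ * ‖D‖ := by field_simp
  have h3 : ‖D‖ ≤ ‖A (w - w')‖ + τ * ‖D‖ := by
    have := norm_add_le (A (w - w')) (D - A (w - w'))
    rw [add_sub_cancel] at this
    linarith
  have h4 : ‖LI I (A (w - w'))‖ ≤ ‖LI I D‖ + ‖LI I‖ * (τ * ‖D‖) := by
    have h5 : LI I (A (w - w')) = LI I D - LI I (D - A (w - w')) := by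
      rw [← map_sub]; congr 1; abel
    rw [h5]
    refine (norm_sub_le _ _).trans (add_le_add_right ?_ _)
    exact ((LI I).le_opNorm _).trans (mul_le_mul_of_nonneg_left h2 (norm_nonneg _))
  have h6 := hA2 (w - w')
  rw [← map_sub]
  have h7 : (2 * K * ‖LI I‖ + 1) * τ = 1 / 2 := by rw [hτ]; field_simp
  have h8 : ‖D‖ ≤ 2 * K * ‖LI I D‖ + ((2 * K * ‖LI I‖ + 1) * τ) * ‖D‖ := by
    have h9 : 2 * K * ‖LI I (A (w - w'))‖ ≤ 2 * K * (‖LI I D‖ + ‖LI I‖ * (τ * ‖D‖)) := by gcongr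
    linarith
  rw [h7] at h8
  linarith

end AnSet

namespace AnSet
open Metric Set Filter Topology

lemma exists_pieces {n N : ℕ} (hnN : n ≤ N) {X : Set (Fin N → ℂ)} {r : ℝ} (hr : 0 < r)
    (hcut : Cut X (ball 0 r)) (hdim : dimH (X ∩ ball 0 r) ≤ (2 * n : ℕ)) :
    ∃ (ρ : ℝ) (M : ℕ) (LI : (Fin n → Fin N) → (Fin N → ℂ) →L[ℂ] (Fin n → ℂ)), 0 < ρ ∧ ρ ≤ r ∧
      (∀ I, Function.Injective I → ∀ w, ∃ s : Finset (Fin N → ℂ), s.card ≤ M ∧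
        ∀ z ∈ X ∩ ball 0 ρ, LI I z = w → z ∈ s) ∧
      ∃ (I : ℕ → (Fin n → Fin N)) (S : ℕ → Set (Fin N → ℂ)), 
        (∀ k, Function.Injective (I k) ∧ MeasurableSet (S k) ∧ ∀ x ∈ S k, ∀ y ∈ S k,
          ‖x - y‖ ≤ (4 * (n + 1)) * ‖LI (I k) x - LI (I k) y‖) ∧ X ∩ ball 0 ρ ⊆ ⋃ k, S k := by
  classical
  have hex : ∀ I : Fin n → Fin N, ∃ (L : (Fin N → ℂ) →L[ℂ] (Fin n → ℂ)) (ρ : ℝ) (M : ℕ), 0 < ρ ∧ ρ ≤ r ∧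
      (Function.Injective I → ‖L - proj I‖ < 1 / (2 * (n + 1)) ∧ Good X L ρ M) := by
    intro I
    by_cases hI : Function.Injective I
    · obtain ⟨L, ρ, M, h1, h2, h3, h4⟩ := noether (n := n) (N - n) (Fin N → ℂ) (by simp; omega) X r hr hcut
        hdim (proj I) (proj_surjective hI) (1 / (2 * (n + 1))) (by positivity)
      exact ⟨L, ρ, M, h2, h3, fun _ => ⟨h1, h4⟩⟩
    · exact ⟨0, r, 0, hr, le_rfl, fun h => absurd h hI⟩
  choose LI ρI MI hρ0 hρr hgood using hex
  set I0 : Fin n → Fin N := Fin.castLE hnN with hI0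
  have hI0inj : Function.Injective I0 := Fin.castLE_injective hnN
  have : Nonempty (Fin n → Fin N) := ⟨I0⟩
  obtain ⟨Imin, hImin⟩ := Finite.exists_min ρI
  have hball : ∀ I, X ∩ ball (0 : Fin N → ℂ) (ρI Imin) ⊆ X ∩ ball 0 (ρI I) := fun I =>
    inter_subset_inter_right _ (ball_subset_ball (hImin I))
  refine ⟨ρI Imin, ∑ I, MI I, LI, hρ0 _, hρr _, ?_, ?_⟩
  · intro I hI w
    obtain ⟨s, hs, h⟩ := (hgood I hI).2.1 w
    exact ⟨s, hs.trans (Finset.single_le_sum (f := MI) (fun _ _ => Nat.zero_le _) (Finset.mem_univ I)),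
      fun z hz => h z (hball I hz)⟩
  · obtain ⟨Gam, hGamc, hGam, hcov⟩ := (hgood I0 hI0inj).2.2
    let Q : (Fin n → Fin N) × Set (Fin N → ℂ) → Prop := fun q => 
      Function.Injective q.1 ∧ MeasurableSet q.2 ∧ ∀ x ∈ q.2, ∀ y ∈ q.2,
          ‖x - y‖ ≤ (4 * (n + 1)) * ‖LI q.1 x - LI q.1 y‖
    have hloc : ∀ g ∈ Gam, ∃ T : Set ((Fin n → Fin N) × Set (Fin N → ℂ)), T.Countable ∧
        (∀ q ∈ T, Q q) ∧ ∀ w ∈ g.1, ∃ q ∈ T, g.2 w ∈ q.2 := by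
      intro g hg
      obtain ⟨hgo, hgd, hgL⟩ := hGam g hg
      have hl : ∀ w : Fin n → ℂ, ∃ (I : Fin n → Fin N) (V : Set (Fin n → ℂ)), w ∈ g.1 → 
          (Function.Injective I ∧ IsOpen V ∧ w ∈ V ∧ V ⊆ g.1 ∧ ∀ w ∈ V, ∀ w' ∈ V, 
      ‖g.2 w - g.2 w'‖ ≤ (4 * (n + 1)) * ‖LI I (g.2 w) - LI I (g.2 w')‖) := by
        intro w
        by_cases hw : w ∈ g.1
        · obtain ⟨I, hI, V, h⟩ := local_antilip hgo hgd hgL LI (fun I hI => (hgood I hI).1.le) hw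
          exact ⟨I, V, fun _ => ⟨hI, h⟩⟩
        · exact ⟨I0, ∅, fun h => absurd h hw⟩
      choose I V hV using hl
      obtain ⟨t, hts, htc, htcov⟩ := TopologicalSpace.countable_cover_nhdsWithin (s := g.1) (f := V)
        (fun w hw => mem_nhdsWithin_of_mem_nhds ((hV w hw).2.1.mem_nhds (hV w hw).2.2.1))
      refine ⟨(fun w => (I w, g.2 '' (V w))) '' t, htc.image _, ?_, ?_⟩
      · rintro _ ⟨w, hw, rfl⟩
        obtain ⟨a1, a2, a3, a4, a5⟩ := hV w (hts hw)
        refine ⟨a1, ?_, ?_⟩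
        · refine a2.measurableSet.image_of_continuousOn_injOn (hgd.continuousOn.mono a4) ?_
          intro x hx y hy hxy
          rw [← hgL x (a4 hx), ← hgL y (a4 hy), hxy]
        · rintro _ ⟨x, hx, rfl⟩ _ ⟨y, hy, rfl⟩
          exact a5 x hx y hy
      · intro w hw
        obtain ⟨w', hw', hm⟩ := mem_iUnion₂.1 (htcov hw)
        exact ⟨_, mem_image_of_mem _ hw', mem_image_of_mem _ hm⟩
    choose! T hTc hTQ hTcov using hloc
    have hc : (insert (I0, ∅) (⋃ g ∈ Gam, T g)).Countable := (hGamc.biUnion hTc).insert _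
    obtain ⟨q, hq⟩ := hc.exists_eq_range (insert_nonempty _ _)
    have hQ : ∀ k, Q (q k) := by
      intro k
      have : q k ∈ insert (I0, ∅) (⋃ g ∈ Gam, T g) := by rw [hq]; exact mem_range_self k
      rcases this with h | h
      · rw [h]
        exact ⟨hI0inj, MeasurableSet.empty, fun x hx => absurd hx (notMem_empty x)⟩
      · obtain ⟨g, hg, hm⟩ := mem_iUnion₂.1 h
        exact hTQ g hg _ hm
    refine ⟨fun k => (q k).1, fun k => (q k).2, hQ, ?_⟩
    intro z hz
    obtain ⟨g, hg, h1, h2⟩ := hcov z (hball I0 hz)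
    obtain ⟨p, hp, hzp⟩ := hTcov g hg _ h1
    rw [h2] at hzp
    have : p ∈ insert (I0, ∅) (⋃ g ∈ Gam, T g) := Or.inr (mem_iUnion₂.2 ⟨g, hg, hp⟩)
    rw [hq] at this
    obtain ⟨k, rfl⟩ := this
    exact mem_iUnion.2 ⟨k, hzp⟩

lemma measurable_of_cut {N : ℕ} {X : Set (Fin N → ℂ)} {r : ℝ} (hcut : Cut X (ball 0 r)) :
    MeasurableSet (X ∩ ball 0 r) := by
  have ho : IsOpen (ball 0 r \ X) := by
    rw [isOpen_iff_mem_nhds]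
    rintro z ⟨hz, hzX⟩
    obtain ⟨h, h1, h2, h3⟩ := hcut z hz hzX
    filter_upwards [(h1.continuousOn.isOpen_inter_preimage isOpen_ball
      isOpen_compl_singleton).mem_nhds (⟨hz, h3⟩ : z ∈ ball 0 r ∩ h ⁻¹' {0}ᶜ)] with w hw
    exact ⟨hw.1, fun hwX => hw.2 (h2 w ⟨hwX, hw.1⟩)⟩
  have : X ∩ ball 0 r = ball 0 r \ (ball 0 r \ X) := by
    rw [sdiff_sdiff_right_self, inter_comm]
  rw [this]
  exact isOpen_ball.measurableSet.diff ho.measurableSet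

lemma hausdorff_ball (n : ℕ) : ∃ c : ENNReal, c < ⊤ ∧ ∀ R : ℝ, 0 < R → 
    μH[(2 * n : ℕ)] (ball (0 : Fin n → ℂ) R) ≤ c * ENNReal.ofReal (R ^ (2 * n)) := by
  have hfr : Module.finrank ℝ (Fin n → ℂ) = 2 * n := by
    rw [finrank_real_of_complex]; simp
  have hH : (μH[(2 * n : ℕ)] : Measure (Fin n → ℂ)).IsAddHaarMeasure := by
    have := isAddHaarMeasure_hausdorffMeasure (E := Fin n → ℂ)
    rwa [hfr] at this
  refine ⟨μH[(2 * n : ℕ)] (ball (0 : Fin n → ℂ) 1), measure_ball_lt_top, ?_⟩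
  intro R hR
  rw [Measure.addHaar_ball_of_pos _ _ hR, hfr, mul_comm]

lemma multiplicity_bound {n N : ℕ} (L : (Fin N → ℂ) →L[ℂ] (Fin n → ℂ)) (M : ℕ) (R : ℝ)
    (A : ℕ → Set (Fin N → ℂ)) (hA : ∀ k, MeasurableSet (A k)) (hdisj : Pairwise (Function.onFun Disjoint A))
    (hinj : ∀ k, InjOn L (A k)) (hR : ∀ k, ∀ z ∈ A k, L z ∈ ball 0 R)
    (hM : ∀ w, ∃ s : Finset (Fin N → ℂ), s.card ≤ M ∧ ∀ k, ∀ z ∈ A k, L z = w → z ∈ s) (d : ℝ) :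
    ∑' k, μH[d] (L '' (A k)) ≤ M * μH[d] (ball (0 : Fin n → ℂ) R) := by
  classical
  have hmeas : ∀ k, MeasurableSet (L '' (A k)) := fun k =>
    (hA k).image_of_continuousOn_injOn L.continuous.continuousOn (hinj k)
  have h1 : ∀ k, μH[d] (L '' (A k)) = ∫⁻ w, (L '' (A k)).indicator (fun _ => (1 : ENNReal)) w ∂μH[d] := by
    intro k
    rw [lintegral_indicator (hmeas k)]
    simp
  simp_rw [h1]
  rw [← lintegral_tsum (fun k => (measurable_const.indicator (hmeas k)).aemeasurable)]
  have h2 : ∀ w, ∑' k, (L '' (A k)).indicator (fun _ => (1 : ENNReal)) w ≤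
      (ball (0 : Fin n → ℂ) R).indicator (fun _ => (M : ENNReal)) w := by
    intro w
    by_cases hw : w ∈ ball (0 : Fin n → ℂ) R
    · rw [indicator_of_mem hw]
      apply ENNReal.tsum_le_of_sum_range_le
      intro K
      obtain ⟨s, hs, hsm⟩ := hM w
      set F := (Finset.range K).filter (fun k => w ∈ L '' (A k)) with hF
      have h3 : ∑ k ∈ Finset.range K, (L '' (A k)).indicator (fun _ => (1 : ENNReal)) w = F.card := by
        simp only [indicator_apply]
        rw [Finset.sum_ite]
        simp [hF]
      rw [h3]
      have h4 : ∀ k ∈ F, ∃ z ∈ A k, L z = w := fun k hk => (Finset.mem_filter.1 hk).2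
      choose! z hzA hzw using h4
      have h5 : F.card ≤ s.card := by
        apply Finset.card_le_card_of_injOn z
        · intro k hk
          exact hsm k _ (hzA k hk) (hzw k hk)
        · intro k hk l hl hkl
          by_contra hne
          exact (disjoint_left.1 (hdisj hne)) (hzA k hk) (hkl ▸ hzA l hl)
      exact_mod_cast h5.trans hs
    · rw [indicator_of_notMem hw]
      simp only [nonpos_iff_eq_zero, ENNReal.tsum_eq_zero]
      intro k
      apply indicator_of_notMem
      rintro ⟨z, hz, rfl⟩
      exact hw (hR k z hz)
  refine (lintegral_mono h2).trans ?_
  rw [lintegral_indicator isOpen_ball.measurableSet]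
  simp

lemma antilip_measure {n N : ℕ} (L : (Fin N → ℂ) →L[ℂ] (Fin n → ℂ)) (C : NNReal) {A : Set (Fin N → ℂ)}
    (hA : ∀ x ∈ A, ∀ y ∈ A, ‖x - y‖ ≤ C * ‖L x - L y‖) {d : ℝ} (hd : 0 ≤ d) :
    μH[d] A ≤ (C : ENNReal) ^ d * μH[d] (L '' A) := by
  have hinj : InjOn L A := by
    intro x hx y hy hxy
    have := hA x hx y hy
    rw [hxy, sub_self, norm_zero, mul_zero] at this
    exact sub_eq_zero.1 (norm_le_zero_iff.1 this)
  have hlip : LipschitzOnWith C (Function.invFunOn L A) (L '' A) := by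
    apply LipschitzOnWith.of_dist_le_mul
    rintro _ ⟨x, hx, rfl⟩ _ ⟨y, hy, rfl⟩
    rw [hinj.leftInvOn_invFunOn hx, hinj.leftInvOn_invFunOn hy, dist_eq_norm, dist_eq_norm]
    exact hA x hx y hy
  have := hlip.hausdorffMeasure_image_le hd
  rwa [hinj.leftInvOn_invFunOn.image_image] at this

/-- The volume growth estimate. -/
lemma volume_growth {n N : ℕ} (hnN : n ≤ N) {X : Set (Fin N → ℂ)} {r : ℝ} (hr : 0 < r)
    (hcut : Cut X (ball 0 r)) (hdim : dimH (X ∩ ball 0 r) ≤ (2 * n : ℕ)) :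
    ∃ (ρ : ℝ) (c : ENNReal), 0 < ρ ∧ ρ ≤ r ∧ c < ⊤ ∧ ∀ R : ℝ, 0 < R → R ≤ ρ →
      μH[(2 * n : ℕ)] (X ∩ ball 0 R) ≤ c * ENNReal.ofReal (R ^ (2 * n)) := by
  classical
  obtain ⟨ρ, M, LI, hρ, hρr, hfib, I, S, hS, hcov⟩ := exists_pieces hnN hr hcut hdim
  obtain ⟨c0, hc0, hball⟩ := hausdorff_ball n
  set C : NNReal := 4 * (n + 1) with hC
  set d : ℝ := ((2 * n : ℕ) : ℝ) with hd
  have hd0 : 0 ≤ d := by positivity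
  refine ⟨ρ, (C : ENNReal) ^ d * ∑ J : Fin n → Fin N, (M * (c0 * ENNReal.ofReal ((‖LI J‖ + 1) ^ (2 * n)))),
    hρ, hρr, ?_, ?_⟩
  · apply ENNReal.mul_lt_top
    · exact ENNReal.rpow_lt_top_of_nonneg hd0 ENNReal.coe_ne_top
    · apply ENNReal.sum_lt_top.2
      intro J _
      exact ENNReal.mul_lt_top (ENNReal.natCast_lt_top M) (ENNReal.mul_lt_top hc0 ENNReal.ofReal_lt_top)
  · intro R hR hRρ
    have hTm : MeasurableSet (X ∩ ball 0 R) := by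
      have := (measurable_of_cut hcut).inter (isOpen_ball (x := (0 : Fin N → ℂ)) (ε := R)).measurableSet
      rwa [inter_assoc, inter_eq_right.2 (ball_subset_ball (hRρ.trans hρr))] at this
    set T := X ∩ ball (0 : Fin N → ℂ) R with hT
    have hTρ : T ⊆ X ∩ ball 0 ρ := inter_subset_inter_right _ (ball_subset_ball hRρ)
    set A : ℕ → Set (Fin N → ℂ) := fun k => T ∩ disjointed S k with hA
    have hAm : ∀ k, MeasurableSet (A k) := fun k =>
      hTm.inter (MeasurableSet.disjointed (fun k => (hS k).2.1) k)
    have hAd : Pairwise (Function.onFun Disjoint A) := fun k l hkl =>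
      ((disjoint_disjointed S) hkl).mono inter_subset_right inter_subset_right
    have hAS : ∀ k, A k ⊆ S k := fun k => inter_subset_right.trans (disjointed_subset S k)
    have hAl : ∀ k, ∀ x ∈ A k, ∀ y ∈ A k, ‖x - y‖ ≤ C * ‖LI (I k) x - LI (I k) y‖ := by
      intro k x hx y hy
      have := (hS k).2.2 x (hAS k hx) y (hAS k hy)
      simpa [hC] using this
    have hTU : T ⊆ ⋃ k, A k := by
      rw [hA, ← inter_iUnion, iUnion_disjointed]
      exact subset_inter subset_rfl (hTρ.trans hcov)
    -- split according to the projection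
    let B : (Fin n → Fin N) → ℕ → Set (Fin N → ℂ) := fun J k => if I k = J then A k else ∅
    have hBA : ∀ J k, B J k ⊆ A k := by
      intro J k
      by_cases h : I k = J
      · simp [B, h]
      · simp [B, h]
    have hJ : ∀ J, ∑' k, μH[d] (LI J '' (B J k)) ≤
        M * (c0 * ENNReal.ofReal ((‖LI J‖ + 1) ^ (2 * n))) * ENNReal.ofReal (R ^ (2 * n)) := by
      intro J
      by_cases hJ : Function.Injective J
      · have h1 : ∑' k, μH[d] (LI J '' (B J k)) ≤ M * μH[d] (ball (0 : Fin n → ℂ) ((‖LI J‖ + 1) * R)) := by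
          apply multiplicity_bound
          · intro k
            by_cases h : I k = J
            · simp [B, h, hAm k]
            · simp [B, h]
          · intro k l hkl
            exact (hAd hkl).mono (hBA J k) (hBA J l)
          · intro k
            by_cases h : I k = J
            · intro x hx y hy hxy
              have := hAl k x (hBA J k hx) y (hBA J k hy)
              rw [h, hxy, sub_self, norm_zero, mul_zero] at this
              exact sub_eq_zero.1 (norm_le_zero_iff.1 this)
            · simp [B, h]
          · intro k z hz
            have hzR : z ∈ ball (0 : Fin N → ℂ) R := (hBA J k hz).1.2
            rw [mem_ball_zero_iff] at hzR ⊢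
            refine ((LI J).le_opNorm z).trans_lt ?_
            nlinarith [norm_nonneg (LI J), norm_nonneg z]
          · intro w
            obtain ⟨s, hs, h⟩ := hfib J hJ w
            exact ⟨s, hs, fun k z hz hzw => h z (hTρ (hBA J k hz).1) hzw⟩
        refine h1.trans ?_
        have h2 := hball ((‖LI J‖ + 1) * R) (by positivity)
        rw [mul_pow, ENNReal.ofReal_mul (by positivity)] at h2
        calc _ ≤ (M : ENNReal) * (c0 * (ENNReal.ofReal ((‖LI J‖ + 1) ^ (2 * n)) * ENNReal.ofReal (R ^ (2 * n)))) := by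
              gcongr
          _ = _ := by ring
      · have : ∀ k, B J k = ∅ := by
          intro k
          have : I k ≠ J := fun h => hJ (h ▸ (hS k).1)
          simp [B, this]
        simp [this]
    calc μH[d] T ≤ μH[d] (⋃ k, A k) := measure_mono hTU
      _ ≤ ∑' k, μH[d] (A k) := measure_iUnion_le _
      _ ≤ ∑' k, (C : ENNReal) ^ d * μH[d] (LI (I k) '' (A k)) :=
          ENNReal.tsum_le_tsum fun k => antilip_measure (LI (I k)) C (hAl k) hd0
      _ = (C : ENNReal) ^ d * ∑' k, μH[d] (LI (I k) '' (A k)) := ENNReal.tsum_mul_left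
      _ ≤ (C : ENNReal) ^ d * ∑' k, ∑ J, μH[d] (LI J '' (B J k)) := by
          gcongr with k
          have h1 : LI (I k) '' (A k) = LI (I k) '' (B (I k) k) := by simp [B]
          rw [h1]
          exact Finset.single_le_sum (f := fun J => μH[d] (LI J '' (B J k))) (fun _ _ => zero_le)
            (Finset.mem_univ (I k))
      _ = (C : ENNReal) ^ d * ∑ J, ∑' k, μH[d] (LI J '' (B J k)) := by
          rw [Summable.tsum_finsetSum (fun _ _ => ENNReal.summable)]
      _ ≤ (C : ENNReal) ^ d * ∑ J, (M * (c0 * ENNReal.ofReal ((‖LI J‖ + 1) ^ (2 * n))) * 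
            ENNReal.ofReal (R ^ (2 * n))) := by
          gcongr with J
          exact hJ J
      _ = _ := by rw [← Finset.sum_mul, mul_assoc]

end AnSet

namespace AnSet
open Metric Set Filter Topology

/-- A pointwise bound for the integrand gives a bound for the set integral. -/
lemma setLIntegral_le_of_bound {α : Type*} [MeasurableSpace α] {μ : Measure α} {s : Set α}
    (hs : MeasurableSet s) {f : α → ENNReal} {a : ENNReal} (h : ∀ z ∈ s, f z ≤ a) :
    ∫⁻ z in s, f z ∂μ ≤ a * μ s := by
  calc ∫⁻ z in s, f z ∂μ ≤ ∫⁻ _ in s, a ∂μ := setLIntegral_mono' hs h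
    _ = a * μ s := setLIntegral_const _ _

lemma norm_sq_le_sum {N : ℕ} (z : Fin N → ℂ) : ‖z‖ ^ 2 ≤ ∑ i, ‖z i‖ ^ 2 := by
  have h0 : 0 ≤ ∑ i, ‖z i‖ ^ 2 := Finset.sum_nonneg fun i _ => sq_nonneg _
  have : ‖z‖ ≤ Real.sqrt (∑ i, ‖z i‖ ^ 2) := by
    rw [pi_norm_le_iff_of_nonneg (Real.sqrt_nonneg _)]
    intro i
    apply Real.le_sqrt_of_sq_le
    exact Finset.single_le_sum (f := fun i => ‖z i‖ ^ 2) (fun i _ => sq_nonneg _)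
      (Finset.mem_univ i)
  calc ‖z‖ ^ 2 ≤ (Real.sqrt (∑ i, ‖z i‖ ^ 2)) ^ 2 := by gcongr
    _ = _ := Real.sq_sqrt h0

/-- Shell summation. -/
lemma shells {N n : ℕ} (hn : 1 ≤ n) {X : Set (Fin N → ℂ)} {ρ : ℝ} (hρ : 0 < ρ) {c : ENNReal}
    (hc : c < ⊤) (hm : MeasurableSet (X ∩ ball 0 ρ))
    (hv : ∀ R, 0 < R → R ≤ ρ → μH[(2 * n : ℕ)] (X ∩ ball 0 R) ≤ c * ENNReal.ofReal (R ^ (2 * n)))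
    {ε : ℝ} (h0 : 0 ≤ ε) (h1 : ε < 1) :
    ∫⁻ z in X ∩ ball 0 ρ, ENNReal.ofReal ((∑ i, ‖z i‖ ^ 2 : ℝ) ^ (-((n : ℝ) - 1 + ε)))
        ∂(μH[(2 * n : ℕ)]) < ⊤ := by
  have hn' : (1 : ℝ) ≤ n := by exact_mod_cast hn
  set s : ℝ := (n : ℝ) - 1 + ε with hs
  have hs0 : 0 ≤ s := by linarith
  set F : (Fin N → ℂ) → ENNReal := fun z => ENNReal.ofReal ((∑ i, ‖z i‖ ^ 2 : ℝ) ^ (-s)) with hF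
  let S : ℕ → Set (Fin N → ℂ) := fun k =>
    (X ∩ ball 0 ρ) ∩ (ball 0 (ρ * (1 / 2) ^ k) \ ball 0 (ρ * (1 / 2) ^ (k + 1)))
  have hcov : X ∩ ball 0 ρ ⊆ {0} ∪ ⋃ k, S k := by
    intro z hz
    by_cases hz0 : z = 0
    · left; exact hz0
    right
    have hzp : 0 < ‖z‖ := norm_pos_iff.2 hz0
    have hzl : ‖z‖ < ρ := by simpa using hz.2
    obtain ⟨k, hk1, hk2⟩ := exists_nat_pow_near_of_lt_one (x := ‖z‖ / ρ) (y := 1 / 2) (by positivity)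
      ((div_le_one hρ).2 hzl.le) (by norm_num) (by norm_num)
    rcases hk2.lt_or_eq with hk2 | hk2
    · refine mem_iUnion.2 ⟨k, hz, ?_, ?_⟩
      · rw [mem_ball_zero_iff]
        rw [div_lt_iff₀ hρ] at hk2; linarith
      · rw [mem_ball_zero_iff, not_lt]
        rw [lt_div_iff₀ hρ] at hk1; linarith
    · cases k with
      | zero =>
        rw [div_eq_iff hρ.ne'] at hk2
        simp at hk2
        linarith
      | succ k =>
        rw [div_eq_iff hρ.ne'] at hk2
        refine mem_iUnion.2 ⟨k, hz, ?_, ?_⟩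
        · rw [mem_ball_zero_iff, hk2, pow_succ]
          have : 0 < (1 / 2 : ℝ) ^ k * ρ := by positivity
          linarith
        · rw [mem_ball_zero_iff, not_lt, hk2]; linarith
  have hSm : ∀ k, MeasurableSet (S k) := fun k =>
    hm.inter (isOpen_ball.measurableSet.diff isOpen_ball.measurableSet)
  set q : ℝ := (1 / 2 : ℝ) ^ (2 * (1 - ε)) with hq
  have hq0 : 0 < q := Real.rpow_pos_of_pos (by norm_num) _
  have hq1 : q < 1 := Real.rpow_lt_one (by norm_num) (by norm_num) (by linarith)
  set A : ℝ := ((ρ * (1 / 2)) ^ 2) ^ (-s) * ρ ^ (2 * n) with hA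
  have hkey : ∀ k : ℕ, ((ρ * (1 / 2) ^ (k + 1)) ^ 2) ^ (-s) * (ρ * (1 / 2) ^ k) ^ (2 * n)
      = A * q ^ k := by
    intro k
    have e1 : (ρ * (1 / 2 : ℝ) ^ (k + 1)) ^ 2 = (ρ * (1 / 2)) ^ 2 * ((1 / 2) ^ k) ^ 2 := by ring
    have hp : (0 : ℝ) < (1 / 2) ^ k := by positivity
    rw [e1, Real.mul_rpow (by positivity) (by positivity), mul_pow, hA]
    have e2 : ((((1 / 2 : ℝ) ^ k) ^ 2) ^ (-s)) * ((1 / 2) ^ k) ^ (2 * n) = q ^ k := by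
      rw [← Real.rpow_natCast _ 2, ← Real.rpow_mul hp.le, ← Real.rpow_natCast _ (2 * n),
        ← Real.rpow_add hp, hq, ← Real.rpow_natCast _ k, ← Real.rpow_natCast _ k,
        ← Real.rpow_mul (by norm_num), ← Real.rpow_mul (by norm_num)]
      congr 1
      push_cast
      rw [hs]; ring_nf
    rw [← e2]; ring
  have hS : ∀ k, ∫⁻ z in S k, F z ∂(μH[(2 * n : ℕ)]) ≤ c * ENNReal.ofReal (A * q ^ k) := by
    intro k
    have hr1 : 0 < ρ * (1 / 2 : ℝ) ^ (k + 1) := by positivity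
    have hr2 : 0 < ρ * (1 / 2 : ℝ) ^ k := by positivity
    have hr3 : ρ * (1 / 2 : ℝ) ^ k ≤ ρ :=
      mul_le_of_le_one_right hρ.le (pow_le_one₀ (by norm_num) (by norm_num))
    refine (setLIntegral_le_of_bound (hSm k)
      (a := ENNReal.ofReal (((ρ * (1 / 2) ^ (k + 1)) ^ 2) ^ (-s))) ?_).trans ?_
    · intro z hz
      have hz2 := hz.2.2
      rw [mem_ball_zero_iff, not_lt] at hz2
      apply ENNReal.ofReal_le_ofReal
      apply Real.rpow_le_rpow_of_nonpos (by positivity) _ (by linarith)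
      calc _ ≤ ‖z‖ ^ 2 := by gcongr
        _ ≤ _ := norm_sq_le_sum z
    · have : μH[(2 * n : ℕ)] (S k) ≤ c * ENNReal.ofReal ((ρ * (1 / 2) ^ k) ^ (2 * n)) :=
        by
        refine (measure_mono ?_).trans (hv _ hr2 hr3)
        exact fun z hz => ⟨hz.1.1, hz.2.1⟩
      calc _ ≤ ENNReal.ofReal (((ρ * (1 / 2) ^ (k + 1)) ^ 2) ^ (-s)) *
            (c * ENNReal.ofReal ((ρ * (1 / 2) ^ k) ^ (2 * n))) := by gcongr
        _ = c * ENNReal.ofReal (A * q ^ k) := by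
          rw [← hkey, ENNReal.ofReal_mul (by positivity)]; ring
  have hsing : ∫⁻ z in {0}, F z ∂(μH[(2 * n : ℕ)]) = 0 := by
    have : NullSingletonClass (μH[(2 * n : ℕ)] : Measure (Fin N → ℂ)) :=
      Measure.nullSingletonClass_hausdorff _ (by push_cast; linarith)
    apply setLIntegral_measure_zero
    exact measure_singleton _
  calc ∫⁻ z in X ∩ ball 0 ρ, F z ∂(μH[(2 * n : ℕ)])
      ≤ ∫⁻ z in {0} ∪ ⋃ k, S k, F z ∂(μH[(2 * n : ℕ)]) := lintegral_mono_set hcov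
    _ ≤ ∫⁻ z in {0}, F z ∂(μH[(2 * n : ℕ)]) + ∫⁻ z in ⋃ k, S k, F z ∂(μH[(2 * n : ℕ)]) :=
        lintegral_union_le _ _ _
    _ ≤ 0 + ∑' k, ∫⁻ z in S k, F z ∂(μH[(2 * n : ℕ)]) := by
        rw [hsing]; gcongr; exact lintegral_iUnion_le _ _
    _ ≤ 0 + ∑' k, c * ENNReal.ofReal (A * q ^ k) := by gcongr with k; exact hS k
    _ = c * ENNReal.ofReal (∑' k, A * q ^ k) := by
        rw [zero_add, ENNReal.tsum_mul_left, ENNReal.ofReal_tsum_of_nonneg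
          (fun k => by positivity) ((summable_geometric_of_lt_one hq0.le hq1).mul_left A)]
    _ < ⊤ := ENNReal.mul_lt_top hc ENNReal.ofReal_lt_top

end AnSet

/-- Let `X` be a pure `n`-dimensional analytic subset of a domain in `ℂ^N` (`N ≥ 2`)
through the origin.  Then there is a neighborhood `U` of `0` such that for every
`0 ≤ ε < 1`, the integral over `U ∩ X` of `(|z_1|^2 + ⋯ + |z_N|^2)^{-(n-1+ε)}` against
the induced volume (the `2n`-dimensional Hausdorff measure) is finite. -/
theorem stmt16 (n N : ℕ) (hN : 2 ≤ N) (D : Set (Fin N → ℂ)) (hD : IsOpen D)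
    (X : Set (Fin N → ℂ)) (hX : IsAnalyticIn X D) (h0X : (0 : Fin N → ℂ) ∈ X)
    (hdim : IsPureDimensional X n) :
    ∃ U ∈ nhds (0 : Fin N → ℂ), ∀ ε : ℝ, 0 ≤ ε → ε < 1 →
      ∫⁻ z in X ∩ U, ENNReal.ofReal ((∑ i, ‖z i‖ ^ 2 : ℝ) ^ (-((n : ℝ) - 1 + ε)))
        ∂(μH[(2 * n : ℕ)]) < ⊤ := by
  obtain ⟨U, hU, hUD, m, f, hf, hXU⟩ := hX.2 0 (hX.1 h0X)
  obtain ⟨r, hr, hrU⟩ := Metric.mem_nhds_iff.1 hU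
  have hcut : AnSet.Cut X (Metric.ball 0 r) := by
    intro z hz hzX
    have h1 : z ∉ X ∩ U := fun h => hzX h.1
    rw [hXU] at h1
    have h2 : ∃ i, f i z ≠ 0 := by
      by_contra hcon
      push Not at hcon
      exact h1 ⟨hrU hz, hcon⟩
    obtain ⟨i, hi⟩ := h2
    refine ⟨f i, (hf i).mono hrU, fun x hx => ?_, hi⟩
    have h3 : x ∈ X ∩ U := ⟨hx.1, hrU hx.2⟩
    rw [hXU] at h3
    exact h3.2 i
  have hd : dimH (X ∩ Metric.ball 0 r) = (2 * n : ℕ) := hdim 0 h0X _ (Metric.ball_mem_nhds 0 hr)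
  have hnN : n ≤ N := by
    have h1 : dimH (X ∩ Metric.ball 0 r) ≤ dimH (Set.univ : Set (Fin N → ℂ)) :=
      dimH_mono (Set.subset_univ _)
    rw [hd, Real.dimH_univ_eq_finrank, finrank_real_of_complex, Module.finrank_fin_fun] at h1
    have h2 : 2 * n ≤ 2 * N := by exact_mod_cast h1
    omega
  obtain ⟨ρ, c, hρ, hρr, hc, hv⟩ := AnSet.volume_growth hnN hr hcut hd.le
  have hm : MeasurableSet (X ∩ Metric.ball 0 ρ) := by
    have := (AnSet.measurable_of_cut hcut).inter
      (Metric.isOpen_ball (x := (0 : Fin N → ℂ)) (ε := ρ)).measurableSet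
    rwa [Set.inter_assoc, Set.inter_eq_right.2 (Metric.ball_subset_ball hρr)] at this
  refine ⟨Metric.ball 0 ρ, Metric.ball_mem_nhds 0 hρ, fun ε h0 h1 => ?_⟩
  rcases Nat.eq_zero_or_pos n with hn | hn
  · refine (AnSet.setLIntegral_le_of_bound hm
      (a := ENNReal.ofReal ((∑ i : Fin N, ρ ^ 2) ^ (-((n : ℝ) - 1 + ε)))) ?_).trans_lt ?_
    · intro z hz
      have hz2 : ‖z‖ < ρ := by simpa using hz.2
      apply ENNReal.ofReal_le_ofReal
      apply Real.rpow_le_rpow (Finset.sum_nonneg fun i _ => sq_nonneg _)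
      · apply Finset.sum_le_sum
        intro i _
        have := norm_le_pi_norm z i
        gcongr
        linarith
      · rw [hn]; push_cast; linarith
    · exact ENNReal.mul_lt_top ENNReal.ofReal_lt_top ((hv ρ hρ le_rfl).trans_lt
        (ENNReal.mul_lt_top hc ENNReal.ofReal_lt_top))
  · exact AnSet.shells hn hρ hc hm hv h0 h1
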